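/- arXiv:1408.1733 — 3 statements merged into one kernel-verified Lean document; each statement's English description precedes it below -/
import Mathlib

section
/- Let F ⊆ K be number fields with [K : F] = 2, and let 𝔟 be a nonzero ideal of 𝒪_F. Let 𝒪_𝔟 := 𝒪_F + 𝔟𝒪_K, an 𝒪_F-order in K, and let Pic(𝒪_𝔟) denote its Picard group, i.e. the group of invertible fractional 𝒪_𝔟-ideals modulo principal ones. Then Pic(𝒪_𝔟) is finite, the index [𝒪_K^× : 𝒪_𝔟^×] is finite, and #Pic(𝒪_𝔟) · [𝒪_K^× : 𝒪_𝔟^×] · #(𝒪_F/𝔟)^× = h_K · #(𝒪_K/𝔟𝒪_K)^×, where h_K is the class number of K. -/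
/-!
Statement 11: for number fields `F ⊆ K` with `[K:F] = 2` and a nonzero ideal `𝔟`
of `𝒪_F`, the order `𝒪_𝔟 = 𝒪_F + 𝔟𝒪_K` has finite Picard group and finite unit
index `[𝒪_K^× : 𝒪_𝔟^×]`, and
`#Pic(𝒪_𝔟) · [𝒪_K^× : 𝒪_𝔟^×] · #(𝒪_F/𝔟)^× = h_K · #(𝒪_K/𝔟𝒪_K)^×`.
-/

open NumberField

/-- The units of `𝒪_K` lying (together with their inverses) in a subring `R` of
`K`, as a subgroup of `𝒪_K^×`; for `R` an order this is `R^× = 𝒪_𝔟^×`. -/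
def unitsInSubring (K : Type*) [Field K] [NumberField K] (R : Subring K) :
    Subgroup (𝓞 K)ˣ where
  carrier := {u | algebraMap (𝓞 K) K u ∈ R ∧
    algebraMap (𝓞 K) K ((u⁻¹ : (𝓞 K)ˣ) : 𝓞 K) ∈ R}
  one_mem' := by simpa using R.one_mem
  mul_mem' := fun {a b} ha hb =>
    ⟨by rw [Units.val_mul, map_mul]; exact R.mul_mem ha.1 hb.1,
     by rw [mul_inv_rev, Units.val_mul, map_mul]; exact R.mul_mem hb.2 ha.2⟩
  inv_mem' := fun {a} ha => ⟨ha.2, by rw [inv_inv]; exact ha.1⟩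

open scoped nonZeroDivisors

namespace Submodule

section Basic

variable (R S A : Type*) [CommRing R] [CommRing A] [Algebra R A]

/-- The invertible `R`-submodules of `A` spanned by units of `A`. -/
noncomputable def unitsSpanSingleton : Aˣ →* (Submodule R A)ˣ :=
  Units.map (spanSingleton R).toMonoidHom

@[simp]
theorem coe_unitsSpanSingleton (x : Aˣ) :
    (unitsSpanSingleton R A x : Submodule R A) = span R {(x : A)} := rfl

/-- Extension of scalars for submodules of an algebra, as a monoid homomorphism. -/
def extendScalarsHom [CommRing S] [Algebra R S] [Algebra S A] [IsScalarTower R S A] :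
    Submodule R A →* Submodule S A where
  toFun J := span S (J : Set A)
  map_one' := by
    rw [one_eq_span, span_span_of_tower, ← one_eq_span]
  map_mul' I J := by
    rw [mul_eq_span_mul_set, span_span_of_tower, span_mul_span]

variable {R A}

@[simp]
theorem extendScalarsHom_apply [CommRing S] [Algebra R S] [Algebra S A] [IsScalarTower R S A]
    (J : Submodule R A) : extendScalarsHom R S A J = span S (J : Set A) := rfl

theorem extendScalarsHom_span_singleton [CommRing S] [Algebra R S] [Algebra S A]
    [IsScalarTower R S A] (x : A) : extendScalarsHom R S A (span R {x}) = span S {x} :=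
  span_span_of_tower R S _

variable (R) in
theorem nat_card_classGroup_eq_index [IsDomain R] (K : Type*) [Field K] [Algebra R K]
    [IsFractionRing R K] :
    Nat.card (ClassGroup R) = (unitsSpanSingleton R K).range.index := by
  rw [Nat.card_congr (ClassGroup.equiv K).toEquiv, ← Subgroup.index,
    ← Subgroup.index_map_equiv _ (FractionalIdeal.unitsMulEquivSubmodule (S := R⁰) (P := K)),
    MonoidHom.map_range]
  congr 2
  ext x : 2
  simp [FractionalIdeal.unitsMulEquivSubmodule]

end Basic

section Dedekind

variable {R O K : Type*} [CommRing R] [CommRing O] [Field K] [Algebra R O] [Algebra R K]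
  [Algebra O K] [IsScalarTower R O K]

theorem exists_isUnit_span_eq {I I' C : Submodule O K} (hI : I * I' = 1)
    (hC : (C : Set K) ⊆ (1 : Submodule R K)) {e e' : K} (he : e ∈ I) (he' : e' ∈ I')
    (h1 : 1 - e * e' ∈ C) (hC1 : C ≤ 1) :
    ∃ J : (Submodule R K)ˣ, span O ((J : Submodule R K) : Set K) = I := by
  have hI' : I' * I = 1 := by rwa [mul_comm]
  have key : (span R {e} ⊔ (C * I).restrictScalars R) *
      (span R {e'} ⊔ (C * I').restrictScalars R) = 1 := by
    have hCC : ∀ {x}, x ∈ C → x ∈ (1 : Submodule R K) := fun h => hC h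
    refine le_antisymm (mul_le.2 fun x hx y hy => ?_) ?_
    · obtain ⟨a, ha, z, hz, rfl⟩ := mem_sup.1 hx
      obtain ⟨b, hb, w, hw, rfl⟩ := mem_sup.1 hy
      obtain ⟨r, rfl⟩ := mem_span_singleton.1 ha
      obtain ⟨s, rfl⟩ := mem_span_singleton.1 hb
      have e1 : e * e' ∈ (1 : Submodule R K) := by
        have := sub_mem (one_le.1 le_rfl) (hCC h1)
        simpa using this
      have hz' : z ∈ C * I := hz
      have hw' : w ∈ C * I' := hw
      have e2 : e * w ∈ C := by
        have := mul_mem_mul hw' he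
        rwa [mul_assoc, hI', mul_one, mul_comm w] at this
      have e3 : e' * z ∈ C := by
        have := mul_mem_mul hz' he'
        rwa [mul_assoc, hI, mul_one, mul_comm z] at this
      have e4 : z * w ∈ C := by
        have := mul_mem_mul hz' hw'
        rw [mul_mul_mul_comm, hI, mul_one] at this
        have h2 := mul_le_mul' hC1 (le_refl C)
        rw [one_mul] at h2
        exact h2 this
      have : (r • e + z) * (s • e' + w) =
          (r * s) • (e * e') + r • (e * w) + s • (e' * z) + z * w := by
        simp only [Algebra.smul_def, map_mul]; ring
      rw [this]
      exact add_mem (add_mem (add_mem (smul_mem _ _ e1) (smul_mem _ _ (hCC e2)))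
        (smul_mem _ _ (hCC e3))) (hCC e4)
    · set J := (span R {e} ⊔ (C * I).restrictScalars R)
      set J' := (span R {e'} ⊔ (C * I').restrictScalars R)
      have hJ : e ∈ J := mem_sup_left (mem_span_singleton_self e)
      have hJ' : e' ∈ J' := mem_sup_left (mem_span_singleton_self e')
      have hJC : ∀ x ∈ C * I, x ∈ J := fun x hx => mem_sup_right hx
      have hJC' : ∀ x ∈ C * I', x ∈ J' := fun x hx => mem_sup_right hx
      have hsub : ∀ c ∈ C, c ∈ J * J' := by
        intro c hc
        have h2 : c * (1 - e * e') ∈ (C * I) * (C * I') := by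
          rw [mul_mul_mul_comm, hI, mul_one]; exact mul_mem_mul hc h1
        have h3 : c * (1 - e * e') ∈ J * J' :=
          Submodule.mul_induction_on h2
            (fun m hm n hn => mul_mem_mul (hJC m hm) (hJC' n hn)) fun _ _ => add_mem
        have h4 : e * (c * e') ∈ J * J' := mul_mem_mul hJ (hJC' _ (mul_mem_mul hc he'))
        convert add_mem h3 h4 using 1; ring
      rw [one_le]
      convert add_mem (hsub _ h1) (mul_mem_mul hJ hJ') using 1; ring
  refine ⟨Units.mkOfMulEqOne _ _ key, le_antisymm (span_le.2 ?_) fun x hx => ?_⟩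
  · intro x hx
    obtain ⟨a, ha, z, hz, rfl⟩ := mem_sup.1 hx
    obtain ⟨r, rfl⟩ := mem_span_singleton.1 ha
    refine add_mem ?_ ?_
    · rw [← IsScalarTower.algebraMap_smul O r e]
      exact smul_mem _ _ he
    · have h2 := mul_le_mul' hC1 (le_refl I)
      rw [one_mul] at h2
      exact h2 hz
  · have h2 : x * e' ∈ (1 : Submodule O K) := by
      rw [← hI]; exact mul_mem_mul hx he'
    obtain ⟨o, ho⟩ := mem_one.1 h2
    have h3 : x = o • e + (1 - e * e') * x := by
      rw [Algebra.smul_def, ho]; ring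
    have h4 : (1 - e * e') * x ∈ C * I := mul_mem_mul h1 hx
    have h5 : (1 - e * e') * x ∈ (C * I).restrictScalars R := h4
    rw [h3]
    exact add_mem (smul_mem _ _ (subset_span (mem_sup_left (mem_span_singleton_self e))))
      (subset_span (mem_sup_right h5))

theorem exists_mul_sub_one_mem [IsDedekindDomain O] [IsFractionRing O K] (𝔠 : Ideal O)
    (h𝔠 : 𝔠 ≠ ⊥) (I : (FractionalIdeal O⁰ K)ˣ) :
    ∃ e ∈ (I : FractionalIdeal O⁰ K), ∃ e' ∈ (↑I⁻¹ : FractionalIdeal O⁰ K),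
      1 - e * e' ∈ (𝔠 : FractionalIdeal O⁰ K) := by
  obtain ⟨d, 𝔞, hd, hI⟩ := FractionalIdeal.exists_eq_spanSingleton_mul (I : FractionalIdeal O⁰ K)
  have h𝔞 : 𝔞 ≠ ⊥ := by
    rintro rfl
    simp at hI
  obtain ⟨a, ha⟩ := IsDedekindDomain.exists_sup_span_eq (I := 𝔠 * 𝔞) (J := 𝔞) Ideal.mul_le_right
    (mul_ne_zero h𝔠 h𝔞)
  have h𝔞' := congr((($ha : Ideal O) : FractionalIdeal O⁰ K))
  have h2 : (1 : FractionalIdeal O⁰ K) = 𝔠 + FractionalIdeal.spanSingleton O⁰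
      ((algebraMap O K d)⁻¹ * algebraMap O K a) * (↑I⁻¹ : FractionalIdeal O⁰ K) := by
    rw [FractionalIdeal.coeIdeal_sup, FractionalIdeal.coeIdeal_mul,
      FractionalIdeal.coeIdeal_span_singleton] at h𝔞'
    have := congr(FractionalIdeal.spanSingleton O⁰ (algebraMap O K d)⁻¹ * $h𝔞' *
      (↑I⁻¹ : FractionalIdeal O⁰ K))
    rw [← hI, Units.mul_inv] at this
    refine this.symm.trans ?_
    rw [mul_add, add_mul, FractionalIdeal.spanSingleton_mul_spanSingleton]
    congr 1
    rw [mul_left_comm, ← hI, mul_assoc, Units.mul_inv, mul_one]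
  have h3 : (1 : K) ∈ (1 : FractionalIdeal O⁰ K) := FractionalIdeal.one_mem_one _
  rw [h2, FractionalIdeal.mem_add] at h3
  obtain ⟨c, hc, y, hy, hcy⟩ := h3
  obtain ⟨e', he', rfl⟩ := FractionalIdeal.mem_singleton_mul.1 hy
  refine ⟨(algebraMap O K d)⁻¹ * algebraMap O K a, ?_, e', he', ?_⟩
  · rw [hI]
    refine FractionalIdeal.mul_mem_mul (FractionalIdeal.mem_spanSingleton_self _ _)
      (FractionalIdeal.mem_coeIdeal_of_mem _ ?_)
    rw [← ha]
    exact Submodule.mem_sup_right (Ideal.mem_span_singleton_self a)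
  · rwa [← hcy, add_sub_cancel_right]

end Dedekind
end Submodule

namespace Submodule

section Conductor

variable {R O : Type*} [CommRing R] [CommRing O] [Algebra R O] {𝔠 : Ideal O}

theorem comap_mk_one (h𝔠 : ∀ x ∈ 𝔠, x ∈ (algebraMap R O).range) :
    (1 : Submodule R (O ⧸ 𝔠)).comap (Ideal.Quotient.mkₐ R 𝔠).toLinearMap = 1 := by
  ext x
  simp only [mem_comap, AlgHom.toLinearMap_apply, mem_one]
  constructor
  · rintro ⟨r, hr⟩
    have h : x - algebraMap R O r ∈ 𝔠 := by
      rw [← Ideal.Quotient.mk_eq_mk_iff_sub_mem]; exact hr.symm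
    obtain ⟨s, hs⟩ := h𝔠 _ h
    exact ⟨s + r, by rw [map_add, hs, sub_add_cancel]⟩
  · rintro ⟨r, rfl⟩
    exact ⟨r, rfl⟩

theorem comap_mk_span_mul (u v : (O ⧸ 𝔠)ˣ) :
    (span R {((u * v : (O ⧸ 𝔠)ˣ) : O ⧸ 𝔠)}).comap (Ideal.Quotient.mkₐ R 𝔠).toLinearMap =
      (span R {(u : O ⧸ 𝔠)}).comap (Ideal.Quotient.mkₐ R 𝔠).toLinearMap *
      (span R {(v : O ⧸ 𝔠)}).comap (Ideal.Quotient.mkₐ R 𝔠).toLinearMap := by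
  have h𝔠u : ∀ (w : (O ⧸ 𝔠)ˣ), ∀ c ∈ 𝔠,
      c ∈ (span R {(w : O ⧸ 𝔠)}).comap (Ideal.Quotient.mkₐ R 𝔠).toLinearMap := fun w c hc => by
    have : Ideal.Quotient.mk 𝔠 c = 0 := Ideal.Quotient.eq_zero_iff_mem.2 hc
    simp [this]
  obtain ⟨a, ha⟩ := Ideal.Quotient.mk_surjective (u : O ⧸ 𝔠)
  obtain ⟨a', ha'⟩ := Ideal.Quotient.mk_surjective ((u⁻¹ : (O ⧸ 𝔠)ˣ) : O ⧸ 𝔠)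
  obtain ⟨b, hb⟩ := Ideal.Quotient.mk_surjective (v : O ⧸ 𝔠)
  have hmem : ∀ (w : (O ⧸ 𝔠)ˣ) (x : O), Ideal.Quotient.mk 𝔠 x = w →
      x ∈ (span R {(w : O ⧸ 𝔠)}).comap (Ideal.Quotient.mkₐ R 𝔠).toLinearMap := fun w x hx => by
    rw [mem_comap, AlgHom.toLinearMap_apply, Ideal.Quotient.mkₐ_eq_mk, hx]
    exact mem_span_singleton_self _
  refine le_antisymm (fun x hx => ?_) ?_
  · obtain ⟨r, hr⟩ := mem_span_singleton.1 (mem_comap.1 hx)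
    have h1 : x - r • (a * b) ∈ 𝔠 := by
      rw [← Ideal.Quotient.mk_eq_mk_iff_sub_mem]
      refine hr.symm.trans ?_
      change _ = Ideal.Quotient.mkₐ R 𝔠 (r • (a * b))
      rw [map_smul, map_mul, Ideal.Quotient.mkₐ_eq_mk, ha, hb, Units.val_mul]
    have h2 : a * a' - 1 ∈ 𝔠 := by
      rw [← Ideal.Quotient.mk_eq_mk_iff_sub_mem, map_mul, ha, ha', Units.mul_inv, map_one]
    set c := x - r • (a * b) with hc
    have h3 : x = r • (a * b) + (a * (a' * c) - (a * a' - 1) * c) := by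
      rw [sub_eq_iff_eq_add.1 hc.symm]; ring
    rw [h3]
    exact add_mem (smul_mem _ _ (mul_mem_mul (hmem u a ha) (hmem v b hb)))
      (sub_mem (mul_mem_mul (hmem u a ha) (h𝔠u v _ (Ideal.mul_mem_left _ _ h1)))
        (mul_mem_mul (h𝔠u u _ h2) (h𝔠u v _ h1)))
  · rw [← map_le_iff_le_comap, Submodule.map_mul, Units.val_mul, ← Set.singleton_mul_singleton, ← span_mul_span]
    exact mul_le_mul' (map_comap_le _ _) (map_comap_le _ _)

variable (K : Type*) [Field K] [Algebra R K] [Algebra O K] [IsScalarTower R O K]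

/-- If the ideal `𝔠` of `O` is contained in the image of `R`, a unit `u` of `O ⧸ 𝔠` gives the
invertible `R`-module of all elements of `O` whose class lies in the `R`-span of `u`. -/
noncomputable def unitsOfQuotient (h𝔠 : ∀ x ∈ 𝔠, x ∈ (algebraMap R O).range) :
    (O ⧸ 𝔠)ˣ →* (Submodule R K)ˣ :=
  MonoidHom.toHomUnits
    { toFun := fun u => ((span R {(u : O ⧸ 𝔠)}).comap
        (Ideal.Quotient.mkₐ R 𝔠).toLinearMap).map (IsScalarTower.toAlgHom R O K).toLinearMap
      map_one' := by
        rw [Units.val_one, ← one_eq_span, comap_mk_one h𝔠, Submodule.map_one]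
      map_mul' := fun u v => by
        rw [comap_mk_span_mul, Submodule.map_mul] }

variable (h𝔠 : ∀ x ∈ 𝔠, x ∈ (algebraMap R O).range)

theorem coe_unitsOfQuotient (u : (O ⧸ 𝔠)ˣ) :
    (unitsOfQuotient K h𝔠 u : Submodule R K) = ((span R {(u : O ⧸ 𝔠)}).comap
        (Ideal.Quotient.mkₐ R 𝔠).toLinearMap).map (IsScalarTower.toAlgHom R O K).toLinearMap :=
  rfl

theorem map_toAlgHom_injective [FaithfulSMul O K] :
    Function.Injective (map (IsScalarTower.toAlgHom R O K).toLinearMap) :=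
  map_injective_of_injective (FaithfulSMul.algebraMap_injective O K)

theorem ker_unitsOfQuotient [FaithfulSMul O K] :
    (unitsOfQuotient K h𝔠).ker = (unitsSpanSingleton R (O ⧸ 𝔠)).ker := by
  ext u
  rw [MonoidHom.mem_ker, MonoidHom.mem_ker, Units.ext_iff, Units.ext_iff, coe_unitsOfQuotient,
    coe_unitsSpanSingleton, Units.val_one, Units.val_one,
    ← Submodule.map_one (IsScalarTower.toAlgHom R O K), ← comap_mk_one h𝔠,
    (map_toAlgHom_injective K).eq_iff,
    (comap_injective_of_surjective (f := (Ideal.Quotient.mkₐ R 𝔠).toLinearMap)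
      Ideal.Quotient.mk_surjective).eq_iff]

theorem unitsOfQuotient_mk (ε : Oˣ) :
    unitsOfQuotient K h𝔠 (Units.map (Ideal.Quotient.mk 𝔠).toMonoidHom ε) =
      unitsSpanSingleton R K (Units.map (algebraMap O K).toMonoidHom ε) := by
  ext1
  have h1 : map (IsScalarTower.toAlgHom R O K).toLinearMap (span R {(ε : O)}) =
      span R {algebraMap O K ε} := by
    rw [map_span, Set.image_singleton]; rfl
  rw [coe_unitsOfQuotient, coe_unitsSpanSingleton]
  refine Eq.trans ?_ h1
  congr 1
  refine le_antisymm (fun x hx => ?_) ?_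
  · obtain ⟨r, hr⟩ := mem_span_singleton.1 (mem_comap.1 hx)
    have h3 : x - r • (ε : O) ∈ 𝔠 := by
      rw [← Ideal.Quotient.mk_eq_mk_iff_sub_mem]
      exact hr.symm
    obtain ⟨s, hs⟩ := h𝔠 _ (Ideal.mul_mem_left _ ((ε⁻¹ : Oˣ) : O) h3)
    refine mem_span_singleton.2 ⟨s + r, ?_⟩
    rw [add_smul, Algebra.smul_def s, hs, mul_right_comm, Units.inv_mul, one_mul, sub_add_cancel]
  · rw [span_le, Set.singleton_subset_iff]
    exact mem_span_singleton_self _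

theorem extendScalarsHom_unitsOfQuotient (u : (O ⧸ 𝔠)ˣ) :
    Units.map (extendScalarsHom R O K) (unitsOfQuotient K h𝔠 u) = 1 := by
  ext1
  rw [Units.coe_map, Units.val_one, extendScalarsHom_apply, coe_unitsOfQuotient]
  refine le_antisymm (span_le.2 ?_) (one_le.2 ?_)
  · rintro _ ⟨x, -, rfl⟩
    exact mem_one.2 ⟨x, rfl⟩
  · obtain ⟨a, ha⟩ := Ideal.Quotient.mk_surjective (u : O ⧸ 𝔠)
    obtain ⟨a', ha'⟩ := Ideal.Quotient.mk_surjective ((u⁻¹ : (O ⧸ 𝔠)ˣ) : O ⧸ 𝔠)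
    have h2 : a * a' - 1 ∈ 𝔠 := by
      rw [← Ideal.Quotient.mk_eq_mk_iff_sub_mem, map_mul, ha, ha', Units.mul_inv, map_one]
    have h3 : (1 : K) = a' • algebraMap O K a - algebraMap O K (a * a' - 1) := by
      rw [Algebra.smul_def, map_sub, map_mul, map_one]; ring
    rw [h3]
    refine sub_mem (smul_mem _ _ (subset_span ⟨a, ?_, rfl⟩)) (subset_span ⟨_, ?_, rfl⟩)
    · change Ideal.Quotient.mk 𝔠 a ∈ span R {(u : O ⧸ 𝔠)}
      rw [ha]
      exact mem_span_singleton_self _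
    · change Ideal.Quotient.mk 𝔠 _ ∈ span R {(u : O ⧸ 𝔠)}
      rw [Ideal.Quotient.eq_zero_iff_mem.2 h2]
      exact zero_mem _

/-- An invertible `R`-submodule of a finite quotient of an extension ring is principal. -/
theorem exists_span_singleton_eq_of_finite_quotient [Finite (O ⧸ 𝔠)]
    (N : (Submodule R (O ⧸ 𝔠))ˣ) : ∃ u : (O ⧸ 𝔠)ˣ, unitsSpanSingleton R (O ⧸ 𝔠) u = N := by
  let S := R ⧸ 𝔠.comap (algebraMap R O)
  have : Finite S := Finite.of_injective (algebraMap S (O ⧸ 𝔠)) Ideal.algebraMap_quotient_injective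
  have : FaithfulSMul S (O ⧸ 𝔠) :=
    (faithfulSMul_iff_algebraMap_injective _ _).2 Ideal.algebraMap_quotient_injective
  have : IsScalarTower R S (O ⧸ 𝔠) := inferInstance
  have : Finite (MaximalSpectrum S) := inferInstance
  have hS : Function.Surjective (algebraMap R S) := Ideal.Quotient.mk_surjective
  have h : Units.map (extendScalarsHom R S (O ⧸ 𝔠)) N ∈ (unitsToPic S (O ⧸ 𝔠)).ker :=
    Subsingleton.elim _ _
  rw [ker_unitsToPic] at h
  obtain ⟨u, hu⟩ := h
  refine ⟨u, Units.ext (SetLike.coe_injective ?_)⟩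
  have h1 := congr((($hu : Submodule S (O ⧸ 𝔠)) : Set (O ⧸ 𝔠)))
  change ((span S {(u : O ⧸ 𝔠)} : Submodule S (O ⧸ 𝔠)) : Set (O ⧸ 𝔠)) =
    (span S ((N : Submodule R (O ⧸ 𝔠)) : Set (O ⧸ 𝔠)) : Submodule S (O ⧸ 𝔠)) at h1
  rw [coe_span_eq_span_of_surjective R S hS, coe_span_eq_span_of_surjective R S hS, span_eq] at h1
  exact h1

variable {K} in
theorem le_one_of_extendScalarsHom_eq_one {J : Submodule R K} (hJ : extendScalarsHom R O K J = 1) :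
    J ≤ map (IsScalarTower.toAlgHom R O K).toLinearMap ⊤ := by
  intro x hx
  have : x ∈ (1 : Submodule O K) := hJ ▸ subset_span hx
  obtain ⟨o, ho⟩ := mem_one.1 this
  exact ⟨o, trivial, ho⟩

variable {K} in
theorem algebraMap_mem_of_extendScalarsHom_eq_one
    (h𝔠 : ∀ x ∈ 𝔠, x ∈ (algebraMap R O).range) {J : Submodule R K}
    (hJ : extendScalarsHom R O K J = 1) {c : O} (hc : c ∈ 𝔠) : algebraMap O K c ∈ J := by
  have key : ∀ x ∈ span O (J : Set K), ∀ c ∈ 𝔠, algebraMap O K c * x ∈ J := by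
    intro x hx
    induction hx using span_induction with
    | mem x hx =>
      intro c hc
      obtain ⟨r, rfl⟩ := h𝔠 c hc
      rw [← IsScalarTower.algebraMap_apply, ← Algebra.smul_def]
      exact smul_mem _ _ hx
    | zero => intro c _; rw [mul_zero]; exact zero_mem _
    | add x y _ _ hx hy => intro c hc; rw [mul_add]; exact add_mem (hx c hc) (hy c hc)
    | smul o x _ hx =>
      intro c hc
      rw [Algebra.smul_def, ← mul_assoc, ← map_mul]
      exact hx _ (Ideal.mul_mem_right _ _ hc)
  have h1 : (1 : K) ∈ span O (J : Set K) := by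
    rw [← extendScalarsHom_apply, hJ]; exact one_le.1 le_rfl
  simpa using key 1 h1 c hc

theorem range_unitsOfQuotient [FaithfulSMul O K] [Finite (O ⧸ 𝔠)] :
    (unitsOfQuotient K h𝔠).range = (Units.map (extendScalarsHom R O K)).ker := by
  refine le_antisymm ?_ fun J hJ => ?_
  · rintro _ ⟨u, rfl⟩
    exact extendScalarsHom_unitsOfQuotient K h𝔠 u
  · have hJ' := inv_mem hJ
    have e : extendScalarsHom R O K J = 1 := congr(($hJ : Submodule O K))
    have e' : extendScalarsHom R O K (J⁻¹ : (Submodule R K)ˣ) = 1 := congr(($hJ' : Submodule O K))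
    let f := IsScalarTower.toAlgHom R O K
    let π := Ideal.Quotient.mkₐ R 𝔠
    have h := map_comap_eq_self (f := f.toLinearMap)
      ((le_one_of_extendScalarsHom_eq_one e).trans_eq (map_top _))
    have h' := map_comap_eq_self (f := f.toLinearMap)
      ((le_one_of_extendScalarsHom_eq_one e').trans_eq (map_top _))
    have h1 : comap f.toLinearMap J * comap f.toLinearMap (J⁻¹ : (Submodule R K)ˣ) = 1 := by
      apply map_toAlgHom_injective K
      rw [Submodule.map_mul, h, h', Units.mul_inv, Submodule.map_one]
    have h2 : map π.toLinearMap (comap f.toLinearMap J) *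
        map π.toLinearMap (comap f.toLinearMap (J⁻¹ : (Submodule R K)ˣ)) = 1 := by
      rw [← Submodule.map_mul, h1, Submodule.map_one]
    obtain ⟨u, hu⟩ := exists_span_singleton_eq_of_finite_quotient (Units.mkOfMulEqOne _ _ h2)
    refine ⟨u, ?_⟩
    ext1
    have h3 : span R {(u : O ⧸ 𝔠)} = map π.toLinearMap (comap f.toLinearMap J) :=
      congr(($hu : Submodule R (O ⧸ 𝔠)))
    rw [coe_unitsOfQuotient, h3]
    refine Eq.trans ?_ h
    congr 1
    rw [comap_map_eq, sup_eq_left]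
    intro c hc
    exact algebraMap_mem_of_extendScalarsHom_eq_one h𝔠 e
      (Ideal.Quotient.eq_zero_iff_mem.1 (LinearMap.mem_ker.1 hc))

theorem comap_unitsOfQuotient_range_unitsSpanSingleton [FaithfulSMul O K] :
    (unitsSpanSingleton R K).range.comap (unitsOfQuotient K h𝔠) =
      (unitsSpanSingleton R (O ⧸ 𝔠)).ker ⊔
        (Units.map (Ideal.Quotient.mk 𝔠).toMonoidHom : Oˣ →* (O ⧸ 𝔠)ˣ).range := by
  refine le_antisymm ?_ (sup_le ?_ ?_)
  · rintro u ⟨x, hx⟩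
    have h1 : unitsSpanSingleton O K x = 1 := by
      rw [← extendScalarsHom_unitsOfQuotient K h𝔠 u, ← hx]
      ext1
      exact (extendScalarsHom_span_singleton O (x : K)).symm
    have h2 : x ∈ (unitsSpanSingleton O K).ker := h1
    rw [unitsSpanSingleton, ker_unitsMap_spanSingleton] at h2
    obtain ⟨ε, rfl⟩ := h2
    rw [← unitsOfQuotient_mk K h𝔠] at hx
    rw [← div_mul_cancel u (Units.map (Ideal.Quotient.mk 𝔠).toMonoidHom ε)]
    refine Subgroup.mul_mem_sup ?_ ⟨ε, rfl⟩
    rw [← ker_unitsOfQuotient K h𝔠, MonoidHom.mem_ker, map_div, hx, div_self']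
  · rw [← ker_unitsOfQuotient K h𝔠]
    exact fun u hu => ⟨1, by rw [map_one, MonoidHom.mem_ker.1 hu]⟩
  · rintro _ ⟨ε, rfl⟩
    exact ⟨_, (unitsOfQuotient_mk K h𝔠 ε).symm⟩

end Conductor

section Index

variable {R O : Type*} [CommRing R] [CommRing O] [Algebra R O] {𝔠 : Ideal O}
  (K : Type*) [Field K] [Algebra R K] [Algebra O K] [IsScalarTower R O K]

theorem extendScalarsHom_units_surjective [IsDedekindDomain O] [IsFractionRing O K]
    (h𝔠 : ∀ x ∈ 𝔠, x ∈ (algebraMap R O).range) (h0 : 𝔠 ≠ ⊥) :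
    Function.Surjective (Units.map (extendScalarsHom R O K)) := by
  intro I
  obtain ⟨I, rfl⟩ := (FractionalIdeal.unitsMulEquivSubmodule (S := O⁰) (P := K)).surjective I
  obtain ⟨e, he, e', he', h1⟩ := exists_mul_sub_one_mem 𝔠 h0 I
  have hI : ((I : FractionalIdeal O⁰ K) : Submodule O K) *
      ((↑I⁻¹ : FractionalIdeal O⁰ K) : Submodule O K) = 1 := by
    rw [← FractionalIdeal.coe_mul, Units.mul_inv, FractionalIdeal.coe_one]
  have hC : (((𝔠 : FractionalIdeal O⁰ K) : Submodule O K) : Set K) ⊆ (1 : Submodule R K) := by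
    intro x hx
    obtain ⟨c, hc, rfl⟩ := (FractionalIdeal.mem_coeIdeal _).1 hx
    obtain ⟨r, rfl⟩ := h𝔠 c hc
    exact mem_one.2 ⟨r, IsScalarTower.algebraMap_apply R O K r⟩
  have hC1 : ((𝔠 : FractionalIdeal O⁰ K) : Submodule O K) ≤ 1 := by
    rw [← FractionalIdeal.coe_one (S := O⁰), FractionalIdeal.coe_le_coe]
    exact FractionalIdeal.coeIdeal_le_one
  obtain ⟨J, hJ⟩ := exists_isUnit_span_eq hI hC he he' h1 hC1
  exact ⟨J, Units.ext hJ⟩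

theorem index_range_unitsSpanSingleton [IsDedekindDomain O] [IsFractionRing O K]
    (h𝔠 : ∀ x ∈ 𝔠, x ∈ (algebraMap R O).range) (h0 : 𝔠 ≠ ⊥)
    [Finite (O ⧸ 𝔠)] :
    (unitsSpanSingleton R K).range.index =
      ((unitsSpanSingleton R (O ⧸ 𝔠)).ker ⊔
        (Units.map (Ideal.Quotient.mk 𝔠).toMonoidHom : Oˣ →* (O ⧸ 𝔠)ˣ).range).index *
      (unitsSpanSingleton O K).range.index := by
  set E := Units.map (extendScalarsHom R O K)
  have hE : ∀ x, E (unitsSpanSingleton R K x) = unitsSpanSingleton O K x := fun x =>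
    Units.ext (extendScalarsHom_span_singleton O (x : K))
  have h1 : (unitsSpanSingleton O K).range.comap E = E.ker ⊔ (unitsSpanSingleton R K).range := by
    refine le_antisymm ?_ (sup_le ?_ ?_)
    · rintro J ⟨x, hx⟩
      rw [← div_mul_cancel J (unitsSpanSingleton R K x)]
      refine Subgroup.mul_mem_sup ?_ ⟨x, rfl⟩
      rw [MonoidHom.mem_ker, map_div, hE, hx, div_self']
    · exact fun J hJ => ⟨1, by rw [map_one, MonoidHom.mem_ker.1 hJ]⟩
    · rintro _ ⟨x, rfl⟩
      exact ⟨x, (hE x).symm⟩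
  rw [← Subgroup.index_comap_of_surjective _ (extendScalarsHom_units_surjective K h𝔠 h0), h1,
    ← Subgroup.relIndex_mul_index (K := E.ker ⊔ (unitsSpanSingleton R K).range) le_sup_right,
    Subgroup.relIndex_sup_right, ← comap_unitsOfQuotient_range_unitsSpanSingleton K h𝔠,
    Subgroup.index_comap, range_unitsOfQuotient K h𝔠]

theorem index_mul_index_mul_card (H : Subgroup (O ⧸ 𝔠)ˣ) :
    (H ⊔ (Units.map (Ideal.Quotient.mk 𝔠).toMonoidHom : Oˣ →* (O ⧸ 𝔠)ˣ).range).index *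
      (H.comap (Units.map (Ideal.Quotient.mk 𝔠).toMonoidHom)).index * Nat.card H =
    Nat.card (O ⧸ 𝔠)ˣ := by
  rw [← H.card_mul_index, ← Subgroup.relIndex_mul_index (H := H) le_sup_left,
    Subgroup.relIndex_sup_left, Subgroup.index_comap]
  ring

end Index

end Submodule

namespace Submodule

section Units

variable {R A : Type*} [CommRing R] [CommRing A] [Algebra R A]

theorem mem_ker_unitsSpanSingleton {u : Aˣ} :
    u ∈ (unitsSpanSingleton R A).ker ↔
      (u : A) ∈ (1 : Submodule R A) ∧ ((u⁻¹ : Aˣ) : A) ∈ (1 : Submodule R A) := by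
  constructor
  · have h : ∀ v ∈ (unitsSpanSingleton R A).ker, (v : A) ∈ (1 : Submodule R A) := fun v hv => by
      have h1 : span R {(v : A)} = 1 := congr(($hv : Submodule R A))
      exact h1 ▸ mem_span_singleton_self _
    exact fun hu => ⟨h u hu, h _ (inv_mem hu)⟩
  · rintro ⟨h, h'⟩
    refine Units.ext (le_antisymm ?_ ?_)
    · simpa [span_le] using h
    · obtain ⟨r, hr⟩ := mem_one.1 h'
      refine one_le.2 (mem_span_singleton.2 ⟨r, ?_⟩)
      rw [Algebra.smul_def, hr, Units.inv_mul]

theorem card_ker_unitsSpanSingleton {B : Type*} [CommRing B] (g : B →+* A)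
    (hg : Function.Injective g) (hr : ∀ x, x ∈ g.range ↔ x ∈ (algebraMap R A).range) :
    Nat.card (unitsSpanSingleton R A).ker = Nat.card Bˣ := by
  have hmem : ∀ x, x ∈ (1 : Submodule R A) ↔ ∃ b, g b = x := fun x => by
    rw [mem_one]; exact (hr x).symm
  have h : (unitsSpanSingleton R A).ker = (Units.map g.toMonoidHom).range := by
    ext u
    rw [mem_ker_unitsSpanSingleton, hmem, hmem]
    constructor
    · rintro ⟨⟨b, hb⟩, b', hb'⟩
      have h1 : b * b' = 1 := hg (by rw [map_mul, hb, hb', Units.mul_inv, map_one])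
      exact ⟨Units.mkOfMulEqOne b b' h1, Units.ext hb⟩
    · rintro ⟨b, rfl⟩
      exact ⟨⟨b, rfl⟩, ⟨(b⁻¹ : Bˣ), rfl⟩⟩
  rw [h]
  exact Nat.card_congr
    (MonoidHom.ofInjective (f := Units.map g.toMonoidHom) (Units.map_injective hg)).symm.toEquiv

theorem mem_comap_ker_unitsSpanSingleton {O : Type*} [CommRing O] [Algebra R O] {𝔠 : Ideal O}
    (h𝔠 : ∀ x ∈ 𝔠, x ∈ (algebraMap R O).range) {ε : Oˣ} :
    ε ∈ (unitsSpanSingleton R (O ⧸ 𝔠)).ker.comap (Units.map (Ideal.Quotient.mk 𝔠).toMonoidHom) ↔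
      (ε : O) ∈ (algebraMap R O).range ∧ ((ε⁻¹ : Oˣ) : O) ∈ (algebraMap R O).range := by
  have h : ∀ x : O, Ideal.Quotient.mk 𝔠 x ∈ (1 : Submodule R (O ⧸ 𝔠)) ↔
      x ∈ (algebraMap R O).range := fun x => by
    have := congr(x ∈ $(comap_mk_one h𝔠))
    rw [mem_one] at this
    exact this.to_iff
  rw [Subgroup.mem_comap, mem_ker_unitsSpanSingleton, ← map_inv]
  exact and_congr (h _) (h _)

end Units

end Submodule

theorem class_number_formula_for_orders
    (F K : Type*) [Field F] [NumberField F] [Field K] [NumberField K]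
    [Algebra F K] (hdeg : Module.finrank F K = 2)
    (𝔟 : Ideal (𝓞 F)) (h𝔟 : 𝔟 ≠ ⊥)
    (R : Subring K)
    -- `R` is the order `𝒪_𝔟 = 𝒪_F + 𝔟𝒪_K`
    (hR : (R : Set K) = {x : K | ∃ (a : 𝓞 F) (y : 𝓞 K),
      y ∈ Ideal.map (algebraMap (𝓞 F) (𝓞 K)) 𝔟 ∧
      x = algebraMap F K (algebraMap (𝓞 F) F a) + algebraMap (𝓞 K) K y}) :
    Finite (ClassGroup ↥R) ∧
    (unitsInSubring K R).index ≠ 0 ∧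
    Nat.card (ClassGroup ↥R) * (unitsInSubring K R).index *
        Nat.card ((𝓞 F ⧸ 𝔟)ˣ) =
      Nat.card (ClassGroup (𝓞 K)) *
        Nat.card ((𝓞 K ⧸ Ideal.map (algebraMap (𝓞 F) (𝓞 K)) 𝔟)ˣ) := by
  set 𝔠 := Ideal.map (algebraMap (𝓞 F) (𝓞 K)) 𝔟
  have hinj : Function.Injective (algebraMap (𝓞 F) (𝓞 K)) :=
    FaithfulSMul.algebraMap_injective _ _
  have h0 : 𝔠 ≠ ⊥ := (Ideal.map_eq_bot_iff_of_injective hinj).not.mpr h𝔟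
  have hmem : ∀ x, x ∈ R ↔ ∃ (a : 𝓞 F), ∃ y ∈ 𝔠,
      x = algebraMap (𝓞 K) K (algebraMap (𝓞 F) (𝓞 K) a + y) := fun x => by
    rw [← SetLike.mem_coe, hR]
    rfl
  have hint : ∀ x : R, (x : K) ∈ integralClosure ℤ K := fun ⟨x, hx⟩ => by
    obtain ⟨a, y, -, rfl⟩ := (hmem x).1 hx
    exact (algebraMap (𝓞 F) (𝓞 K) a + y).2
  let f : R →+* 𝓞 K := R.subtype.codRestrict (integralClosure ℤ K) hint
  let : Algebra R (𝓞 K) := f.toAlgebra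
  have : IsScalarTower R (𝓞 K) K := IsScalarTower.of_algebraMap_eq fun _ => rfl
  have hrange : ∀ x : 𝓞 K, x ∈ (algebraMap R (𝓞 K)).range ↔ algebraMap (𝓞 K) K x ∈ R := fun x =>
    ⟨by rintro ⟨r, rfl⟩; exact r.2, fun h => ⟨⟨_, h⟩, rfl⟩⟩
  have h𝔠 : ∀ x ∈ 𝔠, x ∈ (algebraMap R (𝓞 K)).range := fun x hx =>
    (hrange x).2 ((hmem _).2 ⟨0, x, hx, by rw [map_zero, zero_add]⟩)
  have : Finite (𝓞 K ⧸ 𝔠) := Ideal.finiteQuotientOfFreeOfNeBot 𝔠 h0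
  have : IsFractionRing R K := by
    refine IsFractionRing.of_field R K fun z => ?_
    obtain ⟨c, hc, hc0⟩ := Submodule.exists_mem_ne_zero_of_ne_bot h0
    obtain ⟨a, b, hb, rfl⟩ := IsFractionRing.div_surjective (A := 𝓞 K) z
    obtain ⟨r, hr⟩ := h𝔠 _ (Ideal.mul_mem_right a _ hc)
    obtain ⟨s, hs⟩ := h𝔠 _ (Ideal.mul_mem_right b _ hc)
    refine ⟨r, s, ?_⟩
    rw [IsScalarTower.algebraMap_apply R (𝓞 K) K, IsScalarTower.algebraMap_apply R (𝓞 K) K, hr, hs,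
      map_mul, map_mul, mul_div_mul_left]
    simpa using hc0
  have hcomap : 𝔠.comap (algebraMap (𝓞 F) (𝓞 K)) = 𝔟 :=
    Ideal.comap_map_eq_self_of_faithfullyFlat 𝔟
  let g : 𝓞 F ⧸ 𝔟 →+* 𝓞 K ⧸ 𝔠 := Ideal.quotientMap 𝔠 (algebraMap (𝓞 F) (𝓞 K)) hcomap.ge
  have hg : Function.Injective g := Ideal.quotientMap_injective' hcomap.le
  have hcard := Submodule.card_ker_unitsSpanSingleton (R := R) g hg (fun x => by
    constructor
    · rintro ⟨b, rfl⟩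
      obtain ⟨a, rfl⟩ := Ideal.Quotient.mk_surjective b
      obtain ⟨r, hr⟩ := (hrange (algebraMap (𝓞 F) (𝓞 K) a)).2
        ((hmem _).2 ⟨a, 0, zero_mem _, by rw [add_zero]⟩)
      exact ⟨r, congr(Ideal.Quotient.mk 𝔠 $hr)⟩
    · rintro ⟨r, rfl⟩
      obtain ⟨a, y, hy, hr⟩ := (hmem _).1 r.2
      have hr' : algebraMap R (𝓞 K) r = algebraMap (𝓞 F) (𝓞 K) a + y := RingOfIntegers.ext hr
      refine ⟨Ideal.Quotient.mk 𝔟 a, ?_⟩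
      change Ideal.Quotient.mk 𝔠 (algebraMap (𝓞 F) (𝓞 K) a) =
        Ideal.Quotient.mk 𝔠 (algebraMap R (𝓞 K) r)
      rw [hr', map_add, Ideal.Quotient.eq_zero_iff_mem.2 hy, add_zero])
  have hU : (Submodule.unitsSpanSingleton R (𝓞 K ⧸ 𝔠)).ker.comap
      (Units.map (Ideal.Quotient.mk 𝔠).toMonoidHom) = unitsInSubring K R := by
    ext ε
    rw [Submodule.mem_comap_ker_unitsSpanSingleton h𝔠, hrange, hrange]
    rfl
  have hcount := Submodule.index_mul_index_mul_card (Submodule.unitsSpanSingleton R (𝓞 K ⧸ 𝔠)).ker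
  have hindex := Submodule.index_range_unitsSpanSingleton (R := R) K h𝔠 h0
  rw [← Submodule.nat_card_classGroup_eq_index, ← Submodule.nat_card_classGroup_eq_index] at hindex
  rw [hU, hcard] at hcount
  have hpos : Nat.card (𝓞 K ⧸ 𝔠)ˣ ≠ 0 := Nat.card_pos.ne'
  have hpos' : Nat.card (ClassGroup (𝓞 K)) ≠ 0 := Nat.card_pos.ne'
  rw [← hcount] at hpos
  refine ⟨Nat.finite_of_card_ne_zero ?_, right_ne_zero_of_mul (left_ne_zero_of_mul hpos), ?_⟩
  · rw [hindex]
    exact mul_ne_zero (left_ne_zero_of_mul (left_ne_zero_of_mul hpos)) hpos'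
  · rw [hindex, ← hcount]
    ring
end

section
/- Let K be an imaginary quadratic field of discriminant D < 0, and let χ be the Dirichlet character modulo |D| attached to K, i.e. the quadratic Dirichlet character modulo |D| such that for every prime p not dividing D, χ(p) = 1 if p𝒪_K is a product of two distinct prime ideals and χ(p) = −1 if p𝒪_K is a prime ideal. Then for every integer c ≥ 1, the order 𝒪_c = ℤ + c𝒪_K satisfies #Pic(𝒪_c) = (w_c/(2π)) · c · √|D| · L(1, χ) · ∏_{p prime, p | c}(1 − χ(p)p^{−1}), where w_c = #𝒪_c^× is the number of units of 𝒪_c and L(s, χ) is the Dirichlet L-function of χ. -/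
/-!
Statement 12: for an imaginary quadratic field `K` of discriminant `D < 0` with
attached quadratic Dirichlet character `χ` mod `|D|`, the order `𝒪_c = ℤ + c𝒪_K`
satisfies `#Pic(𝒪_c) = (w_c/(2π)) · c · √|D| · L(1,χ) · ∏_{p ∣ c} (1 - χ(p)p⁻¹)`.
-/

open NumberField

section RelativePicard

open CommRing Submodule
open scoped TensorProduct

universe u

variable {R O : Type u} [CommRing R] [CommRing O] [Algebra R O] (f : Ideal O)

/-- The preimage in `O` of the `R`-submodule of `O ⧸ f` generated by `v`. -/
def comapSpanQuotient (v : O ⧸ f) : Submodule R O :=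
  (span R {v}).comap (Ideal.Quotient.mkₐ R f).toLinearMap

variable {f}

lemma mem_comapSpanQuotient {v : O ⧸ f} {x : O} :
    x ∈ comapSpanQuotient (R := R) f v ↔
      ∃ r : R, Ideal.Quotient.mk f (algebraMap R O r) * v = Ideal.Quotient.mk f x := by
  simp [comapSpanQuotient, mem_span_singleton, Algebra.smul_def]

lemma mem_comapSpanQuotient_of_mem (v : O ⧸ f) {x : O} (hx : x ∈ f) :
    x ∈ comapSpanQuotient (R := R) f v :=
  mem_comapSpanQuotient.mpr ⟨0, by simp [Ideal.Quotient.eq_zero_iff_mem.mpr hx]⟩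

lemma comapSpanQuotient_mul (v w : (O ⧸ f)ˣ) :
    comapSpanQuotient (R := R) f (v * w : (O ⧸ f)ˣ) =
      comapSpanQuotient f (v : O ⧸ f) * comapSpanQuotient f (w : O ⧸ f) := by
  apply le_antisymm
  · intro x hx
    obtain ⟨r, hr⟩ := mem_comapSpanQuotient.mp hx
    obtain ⟨a, ha⟩ := Ideal.Quotient.mk_surjective (v : O ⧸ f)
    obtain ⟨b, hb⟩ := Ideal.Quotient.mk_surjective (w : O ⧸ f)
    obtain ⟨a', ha'⟩ := Ideal.Quotient.mk_surjective (↑v⁻¹ : O ⧸ f)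
    have hav : a ∈ comapSpanQuotient (R := R) f (v : O ⧸ f) :=
      mem_comapSpanQuotient.mpr ⟨1, by simp [ha]⟩
    have hbw : b ∈ comapSpanQuotient (R := R) f (w : O ⧸ f) :=
      mem_comapSpanQuotient.mpr ⟨1, by simp [hb]⟩
    have ht : x - algebraMap R O r * (a * b) ∈ f := by
      rw [← Ideal.Quotient.eq_zero_iff_mem]
      simp [← hr, ha, hb]
    have hs : 1 - a * a' ∈ f := by
      rw [← Ideal.Quotient.eq_zero_iff_mem]
      simp [ha, ha']
    set t := x - algebraMap R O r * (a * b) with ht_def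
    have hx' : x = r • (a * b) + a * (a' * t) + (1 - a * a') * t := by
      rw [Algebra.smul_def, ht_def]; ring
    rw [hx']
    exact add_mem (add_mem (smul_mem _ _ (mul_mem_mul hav hbw))
      (mul_mem_mul hav (mem_comapSpanQuotient_of_mem _ (f.mul_mem_left _ ht))))
      (mul_mem_mul (mem_comapSpanQuotient_of_mem _ hs) (mem_comapSpanQuotient_of_mem _ ht))
  · rw [mul_le]
    intro x hx y hy
    obtain ⟨r, hr⟩ := mem_comapSpanQuotient.mp hx
    obtain ⟨s, hs⟩ := mem_comapSpanQuotient.mp hy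
    exact mem_comapSpanQuotient.mpr ⟨r * s, by simp [← hr, ← hs]; ring⟩

lemma comapSpanQuotient_one (hf : ∀ x ∈ f, x ∈ (algebraMap R O).range) :
    comapSpanQuotient (R := R) f 1 = 1 := by
  ext x
  rw [mem_comapSpanQuotient, mem_one]
  constructor
  · rintro ⟨r, hr⟩
    rw [mul_one, eq_comm, Ideal.Quotient.mk_eq_mk_iff_sub_mem] at hr
    obtain ⟨s, hs⟩ := hf _ hr
    exact ⟨s + r, by simp [hs]⟩
  · rintro ⟨r, rfl⟩
    exact ⟨r, by simp⟩

/-- For an ideal `f` of `O` contained in (the image of) the subring `R`, a unit modulo `f` determines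
an invertible `R`-submodule of `O`. -/
def unitsComapSpanQuotient (hf : ∀ x ∈ f, x ∈ (algebraMap R O).range) :
    (O ⧸ f)ˣ →* (Submodule R O)ˣ :=
  MonoidHom.toHomUnits
    { toFun v := comapSpanQuotient f (v : O ⧸ f)
      map_one' := by simpa using comapSpanQuotient_one hf
      map_mul' := comapSpanQuotient_mul }

@[simp]
lemma coe_unitsComapSpanQuotient (hf : ∀ x ∈ f, x ∈ (algebraMap R O).range) (v : (O ⧸ f)ˣ) :
    (unitsComapSpanQuotient hf v : Submodule R O) = comapSpanQuotient f (v : O ⧸ f) := rfl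

lemma ker_unitsComapSpanQuotient (hf : ∀ x ∈ f, x ∈ (algebraMap R O).range) :
    (unitsComapSpanQuotient hf).ker =
      (Units.map (Ideal.quotientMap f (algebraMap R O) le_rfl).toMonoidHom).range := by
  have key (v : (O ⧸ f)ˣ) (hv : unitsComapSpanQuotient hf v = 1) :
      ∃ r : R, Ideal.Quotient.mk f (algebraMap R O r) = v := by
    obtain ⟨a, ha⟩ := Ideal.Quotient.mk_surjective (v : O ⧸ f)
    have : a ∈ (unitsComapSpanQuotient hf v : Submodule R O) :=
      mem_comapSpanQuotient.mpr ⟨1, by simp [ha]⟩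
    rw [hv, Units.val_one, mem_one] at this
    obtain ⟨r, rfl⟩ := this
    exact ⟨r, ha⟩
  have hinj : Function.Injective (Ideal.quotientMap f (algebraMap R O) le_rfl) :=
    Ideal.quotientMap_injective
  ext v
  rw [MonoidHom.mem_ker]
  constructor
  · intro hv
    obtain ⟨r, hr⟩ := key v hv
    obtain ⟨s, hs⟩ := key v⁻¹ (by rw [map_inv, hv, inv_one])
    refine ⟨⟨Ideal.Quotient.mk _ r, Ideal.Quotient.mk _ s, hinj ?_, hinj ?_⟩, Units.ext ?_⟩
    · simp [hr, hs]
    · simp [hr, hs]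
    · simpa using hr
  · rintro ⟨u, rfl⟩
    obtain ⟨r, hr⟩ := Ideal.Quotient.mk_surjective (u : R ⧸ f.comap (algebraMap R O))
    obtain ⟨s, hs⟩ := Ideal.Quotient.mk_surjective (↑u⁻¹ : R ⧸ f.comap (algebraMap R O))
    have hrs : Ideal.Quotient.mk f (algebraMap R O s) * Ideal.Quotient.mk f (algebraMap R O r)
        = 1 := by
      have := congrArg (Ideal.quotientMap f (algebraMap R O) le_rfl) u.inv_mul
      rwa [← hr, ← hs, map_mul, Ideal.quotientMap_mk, Ideal.quotientMap_mk, map_one] at this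
    rw [Units.ext_iff, coe_unitsComapSpanQuotient, Units.val_one, ← comapSpanQuotient_one hf]
    ext x
    rw [mem_comapSpanQuotient, mem_comapSpanQuotient]
    simp only [Units.coe_map, ← hr, MonoidHom.coe_coe, RingHom.toMonoidHom_eq_coe,
      Ideal.quotientMap_mk, mul_one]
    constructor
    · rintro ⟨a, ha⟩
      exact ⟨a * r, by simp [← ha]⟩
    · rintro ⟨a, ha⟩
      exact ⟨a * s, by rw [map_mul, map_mul, mul_assoc, hrs, mul_one, ha]⟩

lemma span_eq_top_of_isUnit_submodule (J : (Submodule R O)ˣ) :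
    Ideal.span ((J : Submodule R O) : Set O) = ⊤ := by
  rw [Ideal.eq_top_iff_one]
  have h : (1 : O) ∈ (J * J⁻¹ : Submodule R O) := by
    rw [J.mul_inv]; exact one_le.mp le_rfl
  refine Submodule.mul_induction_on h (fun a ha b _ ↦ ?_) (fun _ _ ↦ add_mem)
  exact Ideal.mul_mem_right _ _ (Ideal.subset_span ha)

lemma le_of_isUnit_submodule (hf : ∀ x ∈ f, x ∈ (algebraMap R O).range) (J : (Submodule R O)ˣ)
    {x : O} (hx : x ∈ f) : x ∈ (J : Submodule R O) := by
  suffices ∀ a ∈ Ideal.span ((J : Submodule R O) : Set O), ∀ x ∈ f, x * a ∈ (J : Submodule R O) by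
    simpa using this 1 (by simp [span_eq_top_of_isUnit_submodule]) x hx
  intro a ha
  induction ha using Submodule.span_induction with
  | mem a ha =>
    intro x hx
    obtain ⟨r, rfl⟩ := hf x hx
    simpa [Algebra.smul_def] using smul_mem _ r ha
  | zero => simp
  | add a b _ _ ha hb => intro x hx; rw [mul_add]; exact add_mem (ha x hx) (hb x hx)
  | smul b a _ ha =>
    intro x hx
    rw [smul_eq_mul, ← mul_assoc]
    exact ha _ (f.mul_mem_right _ hx)

lemma exists_generator_mod [FaithfulSMul R O] (I : Ideal R) [Finite (R ⧸ I)]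
    (J : (Submodule R O)ˣ) :
    ∃ v ∈ (J : Submodule R O), ∀ x ∈ (J : Submodule R O), ∃ r : R,
      x - r • v ∈ I • (J : Submodule R O) := by
  have hfree : Module.Free (R ⧸ I) ((R ⧸ I) ⊗[R] (J : Submodule R O)) := inferInstance
  obtain ⟨e⟩ := Module.Invertible.free_iff_linearEquiv.mp hfree
  obtain ⟨v, hv⟩ := TensorProduct.mk_surjective R (J : Submodule R O) (R ⧸ I)
    Ideal.Quotient.mk_surjective (e.symm 1)
  refine ⟨v, v.2, fun x hx ↦ ?_⟩
  obtain ⟨r, hr⟩ := Ideal.Quotient.mk_surjective (e (1 ⊗ₜ ⟨x, hx⟩))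
  refine ⟨r, ?_⟩
  have h1 : (1 : R ⧸ I) ⊗ₜ[R] (⟨x, hx⟩ : (J : Submodule R O)) = 1 ⊗ₜ (r • v) := by
    apply e.injective
    have : (1 : R ⧸ I) ⊗ₜ[R] (r • v) = Ideal.Quotient.mk I r • e.symm 1 := by
      rw [← hv]
      simp [TensorProduct.smul_tmul', Algebra.smul_def]
    rw [this, map_smul, e.apply_symm_apply, smul_eq_mul, mul_one, hr]
  have h2 := congrArg (TensorProduct.quotTensorEquivQuotSMul (J : Submodule R O) I) h1
  rw [← map_one (Ideal.Quotient.mk I), TensorProduct.quotTensorEquivQuotSMul_mk_tmul,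
    TensorProduct.quotTensorEquivQuotSMul_mk_tmul, one_smul, one_smul,
    Submodule.Quotient.eq] at h2
  have h3 := mem_map_of_mem (f := (J : Submodule R O).subtype) h2
  rw [map_smul'', map_subtype_top] at h3
  exact h3

lemma unitsComapSpanQuotient_surjective [FaithfulSMul R O]
    (hf : ∀ x ∈ f, x ∈ (algebraMap R O).range) [Finite (O ⧸ f)] :
    Function.Surjective (unitsComapSpanQuotient hf) := by
  intro J
  have hinj : Function.Injective (Ideal.quotientMap f (algebraMap R O) le_rfl) :=
    Ideal.quotientMap_injective
  have := Finite.of_injective _ hinj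
  obtain ⟨v, hv, hJ⟩ := exists_generator_mod (f.comap (algebraMap R O)) J
  have hJ' (x) (hx : x ∈ (J : Submodule R O)) : ∃ r : R, x - r • v ∈ f := by
    obtain ⟨r, hr⟩ := hJ x hx
    refine ⟨r, Submodule.smul_induction_on hr (fun a ha b _ ↦ ?_) fun _ _ ↦ f.add_mem⟩
    rw [Algebra.smul_def]
    exact f.mul_mem_right _ ha
  have hunit : IsUnit (Ideal.Quotient.mk f v) := by
    rw [← Ideal.span_singleton_eq_top, Ideal.eq_top_iff_one]
    have h : (1 : O) ∈ Ideal.span ((J : Submodule R O) : Set O) := by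
      rw [span_eq_top_of_isUnit_submodule]; trivial
    have : Ideal.span ((J : Submodule R O) : Set O) ≤
        (Ideal.span {Ideal.Quotient.mk f v}).comap (Ideal.Quotient.mk f) := by
      rw [Ideal.span_le]
      intro x hx
      obtain ⟨r, hr⟩ := hJ' x hx
      rw [← Ideal.Quotient.eq_zero_iff_mem, map_sub, sub_eq_zero] at hr
      simp only [SetLike.mem_coe, Ideal.mem_comap, hr, Algebra.smul_def, map_mul]
      exact Ideal.mul_mem_left _ _ (Ideal.mem_span_singleton_self _)
    simpa using this h
  refine ⟨hunit.unit, Units.ext ?_⟩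
  ext x
  rw [coe_unitsComapSpanQuotient, mem_comapSpanQuotient]
  constructor
  · rintro ⟨r, hr⟩
    have h : x - r • v ∈ f := by
      rw [← Ideal.Quotient.eq_zero_iff_mem, map_sub, ← hr]
      simp [Algebra.smul_def]
    simpa using add_mem (le_of_isUnit_submodule hf J h) (smul_mem _ r hv)
  · intro hx
    obtain ⟨r, hr⟩ := hJ' x hx
    rw [← Ideal.Quotient.eq_zero_iff_mem, map_sub, sub_eq_zero] at hr
    exact ⟨r, by simp [hr, Algebra.smul_def]⟩

lemma card_units_submodule_mul_card_units [FaithfulSMul R O]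
    (hf : ∀ x ∈ f, x ∈ (algebraMap R O).range) [Finite (O ⧸ f)] :
    Nat.card (Submodule R O)ˣ * Nat.card (R ⧸ f.comap (algebraMap R O))ˣ =
      Nat.card (O ⧸ f)ˣ := by
  have hinj : Function.Injective (Ideal.quotientMap f (algebraMap R O) le_rfl) :=
    Ideal.quotientMap_injective
  rw [← Subgroup.card_mul_index (unitsComapSpanQuotient hf).ker, Subgroup.index_ker,
    MonoidHom.range_eq_top.mpr (unitsComapSpanQuotient_surjective hf),
    ker_unitsComapSpanQuotient, mul_comm, Subgroup.card_top]
  congr 1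
  exact Nat.card_congr (MonoidHom.ofInjective (Units.map_injective hinj)).toEquiv

lemma card_relPic_mul_card_units [FaithfulSMul R O] :
    Nat.card (relPic R O) * Nat.card Oˣ = Nat.card (Submodule R O)ˣ * Nat.card Rˣ := by
  rw [← Nat.card_congr (unitsQuotEquivRelPic R O).toEquiv,
    ← Subgroup.card_mul_index (Units.map (spanSingleton R (A := O)).toMonoidHom).ker,
    Subgroup.index_ker,
    Subgroup.card_eq_card_quotient_mul_card_subgroup
      (Units.map (spanSingleton R (A := O)).toMonoidHom).range]
  rw [ker_unitsMap_spanSingleton, Nat.card_congr (MonoidHom.ofInjective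
    (Units.map_injective (f := (algebraMap R O).toMonoidHom) (FaithfulSMul.algebraMap_injective R O))).toEquiv.symm]
  ring

end RelativePicard

section PicSurjective

open CommRing
open scoped TensorProduct

universe u

lemma Ideal.invertible_of_mul_eq_span_singleton {R : Type*} [CommRing R] [IsDomain R]
    {I J : Ideal R} {b : R} (hb : b ≠ 0) (h : I * J = Ideal.span {b}) : Module.Invertible R I := by
  let K := FractionRing R
  let φ := Algebra.linearMap R K
  have hφ : Function.Injective φ := FaithfulSMul.algebraMap_injective R K
  have hφb : algebraMap R K b ≠ 0 := by simpa using hb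
  have hmul : Submodule.map φ I * (Submodule.map φ J * Submodule.span R {(algebraMap R K b)⁻¹}) =
      1 := by
    have := Submodule.map_mul I J (Algebra.ofId R K)
    change Submodule.map φ (I * J) = Submodule.map φ I * Submodule.map φ J at this
    rw [← mul_assoc, ← this, h, Ideal.span, Submodule.map_span, Submodule.span_mul_span]
    simp [φ, mul_inv_cancel₀ hφb, Submodule.one_eq_span]
  have hunit : IsUnit (Submodule.map φ I) := .of_mul_eq_one _ hmul
  have : Module.Invertible R (Submodule.map φ I) :=
    inferInstanceAs (Module.Invertible R (hunit.unit : Submodule R K))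
  exact .congr (Submodule.equivMapOfInjective φ hφ I).symm

/-- Ideals which agree up to multiplication by nonzero elements are isomorphic. -/
lemma Ideal.nonempty_linearEquiv_of_span_mul_eq {R : Type*} [CommRing R] [IsDomain R]
    {I J : Ideal R} {a b : R} (ha : a ≠ 0) (hb : b ≠ 0)
    (h : Ideal.span {a} * I = Ideal.span {b} * J) : Nonempty (I ≃ₗ[R] J) := by
  have key (c : R) (L : Ideal R) : Submodule.map (LinearMap.mulLeft R c) L = Ideal.span {c} * L := by
    ext x
    rw [Submodule.mem_map, Ideal.mem_span_singleton_mul]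
    rfl
  have hinj {c : R} (hc : c ≠ 0) : Function.Injective (LinearMap.mulLeft R c) :=
    fun _ _ h ↦ mul_left_cancel₀ hc h
  exact ⟨(Submodule.equivMapOfInjective _ (hinj ha) I).trans <|
    (LinearEquiv.ofEq _ _ (by rw [key, key, h])).trans
      (Submodule.equivMapOfInjective _ (hinj hb) J).symm⟩

section

variable {R O : Type*} [CommRing R] [CommRing O] [Algebra R O] {f : Ideal O}

lemma Ideal.map_comap_of_isCoprime_conductor (hf : ∀ x ∈ f, x ∈ (algebraMap R O).range)
    {I : Ideal O} (hI : IsCoprime I f) :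
    (I.comap (algebraMap R O)).map (algebraMap R O) = I := by
  refine le_antisymm Ideal.map_comap_le fun x hx ↦ ?_
  obtain ⟨a, ha, t, ht, hat⟩ := Ideal.isCoprime_iff_exists.mp hI
  obtain ⟨s, rfl⟩ := hf t ht
  obtain ⟨y, hy⟩ := hf _ (f.mul_mem_left x ht)
  have h1 : algebraMap R O (1 - s) = a := by rw [map_sub, map_one, ← hat]; ring
  have h2 : x = x * algebraMap R O (1 - s) + algebraMap R O y := by
    rw [h1, hy, ← mul_add, hat, mul_one]
  rw [h2]
  refine add_mem (Ideal.mul_mem_left _ _ (Ideal.mem_map_of_mem _ ?_)) (Ideal.mem_map_of_mem _ ?_)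
  · rwa [Ideal.mem_comap, h1]
  · rw [Ideal.mem_comap, hy]
    exact I.mul_mem_right _ hx

lemma Ideal.comap_map_of_isCoprime_conductor [FaithfulSMul R O]
    (hf : ∀ x ∈ f, x ∈ (algebraMap R O).range)
    {J : Ideal R} (hJ : IsCoprime J (f.comap (algebraMap R O))) :
    (J.map (algebraMap R O)).comap (algebraMap R O) = J := by
  refine le_antisymm (fun x hx ↦ ?_) Ideal.le_comap_map
  have key : ∀ z ∈ J.map (algebraMap R O), ∀ t ∈ f, ∃ y ∈ J, algebraMap R O y = t * z := by
    intro z hz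
    induction hz using Submodule.span_induction with
    | mem z hz =>
      obtain ⟨z, hz, rfl⟩ := hz
      intro t ht
      obtain ⟨s, rfl⟩ := hf t ht
      exact ⟨s * z, J.mul_mem_left _ hz, map_mul ..⟩
    | zero => exact fun t _ ↦ ⟨0, J.zero_mem, by simp⟩
    | add z w _ _ hz hw =>
      intro t ht
      obtain ⟨y, hy, hyz⟩ := hz t ht
      obtain ⟨y', hy', hyw⟩ := hw t ht
      exact ⟨y + y', J.add_mem hy hy', by rw [map_add, hyz, hyw, mul_add]⟩
    | smul b z _ hz =>
      intro t ht
      obtain ⟨y, hy, hyz⟩ := hz (t * b) (f.mul_mem_right _ ht)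
      exact ⟨y, hy, by rw [hyz, smul_eq_mul, mul_assoc]⟩
  obtain ⟨a, ha, t, ht, hat⟩ := Ideal.isCoprime_iff_exists.mp hJ
  obtain ⟨y, hy, hyx⟩ := key _ hx _ ht
  rw [← map_mul] at hyx
  rw [← one_mul x, ← hat, add_mul, ← FaithfulSMul.algebraMap_injective R O hyx]
  exact J.add_mem (J.mul_mem_right _ ha) hy

lemma Ideal.isCoprime_comap_of_isCoprime_conductor (hf : ∀ x ∈ f, x ∈ (algebraMap R O).range)
    {I : Ideal O} (hI : IsCoprime I f) :
    IsCoprime (I.comap (algebraMap R O)) (f.comap (algebraMap R O)) := by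
  obtain ⟨a, ha, t, ht, hat⟩ := Ideal.isCoprime_iff_exists.mp hI
  obtain ⟨s, rfl⟩ := hf t ht
  refine Ideal.isCoprime_iff_exists.mpr ⟨1 - s, ?_, s, ht, by ring⟩
  rw [Ideal.mem_comap, map_sub, map_one, ← hat]
  simpa using ha

end

variable {R O : Type u} [CommRing R] [CommRing O] [IsDomain R] [IsDedekindDomain O] [Algebra R O]
  [FaithfulSMul R O] {f : Ideal O}

lemma invertible_comap_of_isCoprime (hf : ∀ x ∈ f, x ∈ (algebraMap R O).range)
    {I : Ideal O} (hI0 : I ≠ ⊥) (hI : IsCoprime I f) :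
    Module.Invertible R (I.comap (algebraMap R O)) := by
  obtain ⟨b, hb, hb0, hbf⟩ : ∃ b ∈ I, b ≠ 0 ∧ 1 - b ∈ f := by
    obtain ⟨a, ha, t, ht, hat⟩ := Ideal.isCoprime_iff_exists.mp hI
    by_cases ha0 : a = 0
    · obtain ⟨y, hy, hy0⟩ := Submodule.exists_mem_ne_zero_of_ne_bot hI0
      refine ⟨y, hy, hy0, ?_⟩
      rw [(Ideal.eq_top_iff_one f).mpr (by rwa [← hat, ha0, zero_add])]
      trivial
    · exact ⟨a, ha, ha0, by rwa [← hat, add_sub_cancel_left]⟩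
  obtain ⟨I', hI'⟩ := Ideal.dvd_iff_le.mpr ((Ideal.span_singleton_le_iff_mem I).mpr hb)
  have hbI' : b ∈ I' := by
    have : b ∈ I * I' := by
      rw [← hI']
      exact Ideal.mem_span_singleton_self b
    exact Ideal.mul_le_right this
  have hI'f : IsCoprime I' f := Ideal.isCoprime_iff_exists.mpr ⟨b, hbI', _, hbf, by ring⟩
  obtain ⟨s, hs⟩ := hf _ hbf
  have hb' : algebraMap R O (1 - s) = b := by rw [map_sub, hs, map_one]; ring
  refine Ideal.invertible_of_mul_eq_span_singleton (J := I'.comap (algebraMap R O))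
    (b := 1 - s) (fun h ↦ hb0 (by rw [← hb', h, map_zero])) ?_
  have hc1 := Ideal.isCoprime_comap_of_isCoprime_conductor hf hI
  have hc2 := Ideal.isCoprime_comap_of_isCoprime_conductor hf hI'f
  have hc3 : IsCoprime (Ideal.span {1 - s}) (f.comap (algebraMap R O)) :=
    Ideal.isCoprime_iff_exists.mpr ⟨_, Ideal.mem_span_singleton_self _, s,
      by rwa [Ideal.mem_comap, hs], by ring⟩
  rw [← Ideal.comap_map_of_isCoprime_conductor hf (hc1.mul_left hc2), Ideal.map_mul,
    Ideal.map_comap_of_isCoprime_conductor hf hI, Ideal.map_comap_of_isCoprime_conductor hf hI'f,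
    ← hI', ← Ideal.comap_map_of_isCoprime_conductor hf hc3, Ideal.map_span, Set.image_singleton,
    hb']

lemma IsDedekindDomain.exists_isCoprime_linearEquiv (hf0 : f ≠ ⊥) {I : Ideal O} (hI : I ≠ ⊥) :
    ∃ J : Ideal O, J ≠ ⊥ ∧ IsCoprime J f ∧ Nonempty (J ≃ₗ[O] I) := by
  by_cases hf1 : f = ⊤
  · exact ⟨I, hI, by simp [hf1, Ideal.isCoprime_iff_sup_eq], ⟨.refl ..⟩⟩
  obtain ⟨a₀, ha₀, ha₀'⟩ := Submodule.exists_mem_ne_zero_of_ne_bot hI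
  obtain ⟨I', hI'⟩ := Ideal.dvd_iff_le.mpr ((Ideal.span_singleton_le_iff_mem I).mpr ha₀)
  have hI'0 : I' ≠ 0 := by
    rintro rfl
    simp [ha₀'] at hI'
  obtain ⟨a, ha⟩ := IsDedekindDomain.exists_sup_span_eq (I := I' * f) (J := I') Ideal.mul_le_left
    (mul_ne_zero hI'0 hf0)
  have ha' : a ∈ I' := by
    rw [← Ideal.span_singleton_le_iff_mem, ← ha]
    exact le_sup_right
  obtain ⟨J, hJ⟩ := Ideal.dvd_iff_le.mpr ((Ideal.span_singleton_le_iff_mem I').mpr ha')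
  have hJf : IsCoprime J f := by
    rw [Ideal.isCoprime_iff_sup_eq, sup_comm]
    rw [hJ, ← Ideal.mul_sup] at ha
    exact mul_left_cancel₀ hI'0 (ha.trans (Ideal.mul_top I').symm)
  have hJ0 : J ≠ ⊥ := by
    rintro rfl
    exact hf1 (by simpa [Ideal.isCoprime_iff_sup_eq] using hJf)
  have ha0 : a ≠ 0 := by
    rintro rfl
    simp only [Ideal.span_singleton_zero] at hJ
    exact mul_ne_zero hI'0 hJ0 hJ.symm
  refine ⟨J, hJ0, hJf, Ideal.nonempty_linearEquiv_of_span_mul_eq ha₀' ha0 ?_⟩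
  rw [hI', hJ]
  ring

lemma mapAlgebra_surjective_of_conductor (hf : ∀ x ∈ f, x ∈ (algebraMap R O).range)
    (hf0 : f ≠ ⊥) : Function.Surjective (Pic.mapAlgebra R O) := by
  intro M
  obtain ⟨I₀, ⟨e⟩⟩ := Module.Invertible.exists_linearEquiv_ideal O M
  have hI₀ : I₀ ≠ ⊥ := by
    rintro rfl
    have := e.toEquiv.subsingleton
    have h : (1 : O) = 0 := FaithfulSMul.eq_of_smul_eq_smul (α := M) fun _ ↦ Subsingleton.elim ..
    exact one_ne_zero h
  obtain ⟨I, hI0, hIf, ⟨e'⟩⟩ := IsDedekindDomain.exists_isCoprime_linearEquiv hf0 hI₀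
  have := invertible_comap_of_isCoprime hf hI0 hIf
  have : Module.Invertible O I := .congr (e.trans e'.symm)
  set J := I.comap (algebraMap R O)
  let φ₀ : O ⊗[R] J →ₗ[O] O :=
    LinearMap.liftBaseChange O ((Algebra.linearMap R O).comp J.subtype)
  have hφ₀ (b : O) (j : J) : φ₀ (b ⊗ₜ j) = b * algebraMap R O j := by simp [φ₀]
  have hrange : LinearMap.range φ₀ = I := by
    refine le_antisymm ?_ ?_
    · rintro _ ⟨z, rfl⟩
      induction z with
      | zero => simp
      | tmul b j => rw [hφ₀]; exact I.mul_mem_left _ j.2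
      | add z w hz hw => rw [map_add]; exact I.add_mem hz hw
    · rw [← Ideal.map_comap_of_isCoprime_conductor hf hIf]
      refine Submodule.span_le.mpr ?_
      rintro _ ⟨j, hj, rfl⟩
      exact ⟨1 ⊗ₜ ⟨j, hj⟩, by rw [hφ₀, one_mul]⟩
  let φ : O ⊗[R] J →ₗ[O] I := φ₀.codRestrict I fun z ↦ by
    rw [← hrange]
    exact ⟨z, rfl⟩
  have hφ : Function.Surjective φ := by
    rintro ⟨x, hx⟩
    rw [← hrange] at hx
    obtain ⟨z, hz⟩ := hx
    exact ⟨z, Subtype.ext hz⟩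
  refine ⟨Pic.mk R J, ?_⟩
  rw [Pic.mapAlgebra_apply, ← Pic.mk_eq_self (M := M), Pic.mk_eq_mk_iff]
  exact ⟨(TensorProduct.AlgebraTensorModule.congr (.refl O O) (Pic.mk.linearEquiv R J)).trans <|
    (LinearEquiv.ofBijective φ (Module.Invertible.bijective_of_surjective hφ)).trans
      (e'.trans e.symm)⟩

end PicSurjective

section CardClassGroup

open CommRing

universe u

variable {R O : Type u} [CommRing R] [CommRing O] [IsDomain R] [IsDedekindDomain O] [Algebra R O]
  [FaithfulSMul R O] {f : Ideal O}

theorem card_classGroup_mul_card_units (hf : ∀ x ∈ f, x ∈ (algebraMap R O).range) (hf0 : f ≠ ⊥)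
    [Finite (O ⧸ f)] :
    Nat.card (ClassGroup R) * Nat.card Oˣ * Nat.card (R ⧸ f.comap (algebraMap R O))ˣ =
      Nat.card (ClassGroup O) * Nat.card (O ⧸ f)ˣ * Nat.card Rˣ := by
  have h1 : Nat.card (Pic R) = Nat.card (relPic R O) * Nat.card (Pic O) := by
    have h := Subgroup.card_mul_index (relPic R O)
    have h2 : (relPic R O).index = Nat.card (Pic O) := by
      rw [relPic, Subgroup.index_ker, MonoidHom.range_eq_top.mpr
        (mapAlgebra_surjective_of_conductor hf hf0)]
      exact Subgroup.card_top
    rw [← h, h2]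
  rw [Nat.card_congr (ClassGroup.equivPic R).toEquiv, Nat.card_congr (ClassGroup.equivPic O).toEquiv,
    h1, ← card_units_submodule_mul_card_units hf]
  linear_combination Nat.card (Pic O) * Nat.card (R ⧸ f.comap (algebraMap R O))ˣ *
    card_relPic_mul_card_units (R := R) (O := O)

end CardClassGroup

section Quadratic

open NumberField Ideal

variable {K : Type*} [Field K] [NumberField K]

lemma isUnramifiedAt_int_iff {P : Ideal (𝓞 K)} [P.IsPrime] {p : ℕ} (hp : p.Prime)
    (hP : (p : 𝓞 K) ∈ P) : Algebra.IsUnramifiedAt ℤ P ↔ ¬ P ^ 2 ∣ span {(p : 𝓞 K)} := by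
  have hp0 : P ≠ ⊥ := by
    rintro rfl
    simp [hp.ne_zero] at hP
  have hpZ : Prime (p : ℤ) := Nat.prime_iff_prime_int.mp hp
  have hpmax : (span {(p : ℤ)}).IsMaximal :=
    ((span_singleton_prime hpZ.ne_zero).mpr hpZ).isMaximal (by simpa using hpZ.ne_zero)
  have : P.LiesOver (span {(p : ℤ)}) := (liesOver_span_iff IsPrime.ne_top' hpZ).mpr (by simpa using hP)
  have hunder : P.under ℤ = span {(p : ℤ)} := (over_def P _).symm
  have : (P.under ℤ).IsMaximal := hunder ▸ hpmax
  have : Finite (ℤ ⧸ P.under ℤ) := by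
    rw [hunder]
    have : NeZero p := ⟨hp.ne_zero⟩
    exact Finite.of_equiv _ (Int.quotientSpanNatEquivZMod p).symm.toEquiv
  have : Finite (P.under ℤ).ResidueField :=
    Finite.of_surjective _ (P.under ℤ).bijective_algebraMap_quotient_residueField.surjective
  have hmap : (span {(p : ℤ)}).map (algebraMap ℤ (𝓞 K)) = span {(p : 𝓞 K)} := by
    simp [map_span]
  rw [← ramificationIdx_eq_one_iff, dvd_iff_le, ← hmap, ← ramificationIdx'_ne_one_iff, not_ne_iff,
    ramificationIdx'_eq_ramificationIdx _ _ (by simpa using hp.ne_zero)]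
  · rw [hmap]; simpa [span_le] using hP

theorem natCast_prime_trichotomy (hK : Module.finrank ℚ K = 2) {p : ℕ} (hp : p.Prime) :
    ((∃ P Q : Ideal (𝓞 K), P ≠ Q ∧ P.IsPrime ∧ Q.IsPrime ∧ span {(p : 𝓞 K)} = P * Q ∧
      absNorm P = p ∧ absNorm Q = p) ∧ ¬ (p : ℤ) ∣ discr K) ∨
    ((span {(p : 𝓞 K)}).IsPrime ∧ absNorm (span {(p : 𝓞 K)}) = p ^ 2 ∧ ¬ (p : ℤ) ∣ discr K) ∨
    ((∃ P : Ideal (𝓞 K), P.IsPrime ∧ span {(p : 𝓞 K)} = P * P ∧ absNorm P = p) ∧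
      (p : ℤ) ∣ discr K) := by
  have hpZ : Prime (p : ℤ) := Nat.prime_iff_prime_int.mp hp
  have hN : absNorm (span {(p : 𝓞 K)}) = p ^ 2 := by
    rw [absNorm_span_natCast, RingOfIntegers.rank, hK]
  have hdisc : ¬ (p : ℤ) ∣ discr K ↔
      ∀ P : Ideal (𝓞 K), P.IsPrime → (p : 𝓞 K) ∈ P → ¬ P ^ 2 ∣ span {(p : 𝓞 K)} := by
    rw [not_dvd_discr_iff_forall_mem K (𝓞 K) hpZ]
    refine forall₂_congr fun P hP ↦ ?_
    rw [Int.cast_natCast]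
    exact forall_congr' fun h ↦ isUnramifiedAt_int_iff hp h
  have hne : span {(p : 𝓞 K)} ≠ ⊤ := by
    intro h
    rw [h, absNorm_top] at hN
    exact hp.one_lt.ne' ((Nat.pow_eq_one.mp hN.symm).resolve_right two_ne_zero)
  have hbot : span {(p : 𝓞 K)} ≠ ⊥ := by simpa using hp.ne_zero
  obtain ⟨P, hPmax, hP⟩ := exists_le_maximal _ hne
  obtain ⟨Q, hQ⟩ := dvd_iff_le.mpr hP
  have hNN : absNorm P * absNorm Q = p ^ 2 := by rw [← map_mul, ← hQ, hN]
  have hP1 : absNorm P ≠ 1 := by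
    rw [Ne, absNorm_eq_one_iff]
    exact hPmax.ne_top
  have ne_zero_of_mem {L : Ideal (𝓞 K)} (hL : (p : 𝓞 K) ∈ L) : L ≠ 0 := by
    rintro rfl
    simp [hp.ne_zero] at hL
  have mem_of {I J : Ideal (𝓞 K)} (h : span {(p : 𝓞 K)} = I * J)
      {L : Ideal (𝓞 K)} (hL : L.IsPrime) (hL' : (p : 𝓞 K) ∈ L) : I ≤ L ∨ J ≤ L := by
    rw [← hL.mul_le, ← h, span_singleton_le_iff_mem]
    exact hL'
  obtain ⟨k, hk, hk'⟩ := (Nat.dvd_prime_pow hp).mp (Dvd.intro _ hNN)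
  interval_cases k
  · simp [hP1] at hk'
  · rw [pow_one] at hk'
    have hQn : absNorm Q = p := by
      rw [hk', sq] at hNN
      exact Nat.eq_of_mul_eq_mul_left hp.pos hNN
    have hQp : Q.IsPrime := isPrime_of_irreducible_absNorm (hQn ▸ hp)
    by_cases hPQ : P = Q
    · subst hPQ
      refine .inr (.inr ⟨⟨P, hQp, hQ, hk'⟩, not_not.mp ?_⟩)
      rw [hdisc]
      push Not
      exact ⟨P, hQp, hP (mem_span_singleton_self _), by rw [hQ, sq]⟩
    · refine .inl ⟨⟨P, Q, hPQ, hPmax.isPrime, hQp, hQ, hk', hQn⟩, hdisc.mpr fun L hL hL' hL2 ↦ ?_⟩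
      have hQmax : Q.IsMaximal := hQp.isMaximal (by rintro rfl; simp [hbot] at hQ)
      rw [hQ, sq] at hL2
      have hL0 : L ≠ 0 := ne_zero_of_mem hL'
      rcases mem_of hQ hL hL' with h | h
      · obtain rfl := hPmax.eq_of_le hL.ne_top h
        rw [mul_dvd_mul_iff_left hL0] at hL2
        exact hPQ (hQmax.eq_of_le hL.ne_top (le_of_dvd hL2)).symm
      · obtain rfl := hQmax.eq_of_le hL.ne_top h
        rw [mul_dvd_mul_iff_right hL0] at hL2
        exact hPQ (hPmax.eq_of_le hL.ne_top (le_of_dvd hL2))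
  · have hQ1 : Q = 1 := by
      rw [one_eq_top, ← absNorm_eq_one_iff]
      exact Nat.eq_of_mul_eq_mul_left (pow_pos hp.pos 2) (by rw [← hk', hNN, hk', mul_one])
    rw [hQ1, mul_one] at hQ
    refine .inr (.inl ⟨hQ ▸ hPmax.isPrime, hN, hdisc.mpr fun L hL hL' hL2 ↦ ?_⟩)
    obtain rfl := (hQ ▸ hPmax).eq_of_le hL.ne_top ((span_singleton_le_iff_mem L).mpr hL')
    have h := dvd_antisymm (Dvd.intro _ (sq _).symm) hL2
    rw [← one_eq_top] at hne
    rw [sq, eq_comm, mul_eq_left₀ hbot] at h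
    exact hne h

end Quadratic

section IdealCount

open NumberField Ideal

section

variable {K : Type*} [Field K] [NumberField K]

lemma isCoprime_of_coprime_absNorm {I J : Ideal (𝓞 K)} (h : (absNorm I).Coprime (absNorm J)) :
    IsCoprime I J := by
  rw [isCoprime_iff_sup_eq, ← absNorm_eq_one_iff]
  exact Nat.eq_one_of_dvd_coprimes h (absNorm_dvd_absNorm_of_le le_sup_left)
    (absNorm_dvd_absNorm_of_le le_sup_right)

lemma exists_mul_eq_of_absNorm_eq_mul {m n : ℕ} (hm : m ≠ 0) (hn : n ≠ 0) (hmn : m.Coprime n)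
    {L : Ideal (𝓞 K)} (hL : absNorm L = m * n) :
    ∃ I J : Ideal (𝓞 K), absNorm I = m ∧ absNorm J = n ∧ I * J = L := by
  have h : L ∣ span {(m : 𝓞 K)} * span {(n : 𝓞 K)} := by
    rw [span_singleton_mul_span_singleton, ← Nat.cast_mul, ← hL, dvd_iff_le,
      span_singleton_le_iff_mem]
    exact absNorm_mem L
  obtain ⟨I, J, hI, hJ, rfl⟩ := exists_dvd_and_dvd_of_dvd_mul h
  rw [map_mul] at hL
  have hI' := map_dvd absNorm hI
  have hJ' := map_dvd absNorm hJ
  rw [absNorm_span_natCast] at hI' hJ'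
  have hIm : absNorm I ∣ m :=
    ((hmn.pow_left _).coprime_dvd_left hI').dvd_of_dvd_mul_right (hL ▸ dvd_mul_right ..)
  have hJn : absNorm J ∣ n :=
    ((hmn.symm.pow_left _).coprime_dvd_left hJ').dvd_of_dvd_mul_left (hL ▸ dvd_mul_left ..)
  have hIle := Nat.le_of_dvd (Nat.pos_of_ne_zero hm) hIm
  have hJle := Nat.le_of_dvd (Nat.pos_of_ne_zero hn) hJn
  refine ⟨I, J, ?_, ?_, rfl⟩
  · refine hIle.antisymm ?_
    by_contra! h
    have := Nat.mul_lt_mul_of_lt_of_le h hJle (Nat.pos_of_ne_zero hn)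
    omega
  · refine hJle.antisymm ?_
    by_contra! h
    have := Nat.mul_lt_mul_of_le_of_lt hIle h (Nat.pos_of_ne_zero hm)
    omega

lemma dvd_of_mul_eq_mul_of_coprime_absNorm {m n : ℕ} (hmn : m.Coprime n)
    {I J I' J' : Ideal (𝓞 K)} (hI : absNorm I = m) (hJ' : absNorm J' = n)
    (h : I * J = I' * J') : I ∣ I' :=
  (isCoprime_of_coprime_absNorm (by rwa [hI, hJ'])).dvd_of_dvd_mul_right (h ▸ dvd_mul_right ..)

variable (K) in
theorem card_ideal_absNorm_eq_mul {m n : ℕ} (hm : m ≠ 0) (hn : n ≠ 0) (hmn : m.Coprime n) :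
    Nat.card {I : Ideal (𝓞 K) // absNorm I = m * n} =
      Nat.card {I : Ideal (𝓞 K) // absNorm I = m} *
        Nat.card {I : Ideal (𝓞 K) // absNorm I = n} := by
  rw [← Nat.card_prod]
  symm
  refine Nat.card_congr (Equiv.ofBijective
    (fun x ↦ ⟨x.1.1 * x.2.1, by rw [map_mul, x.1.2, x.2.2]⟩) ⟨?_, ?_⟩)
  · rintro ⟨⟨I, hI⟩, ⟨J, hJ⟩⟩ ⟨⟨I', hI'⟩, ⟨J', hJ'⟩⟩ h
    have h : I * J = I' * J' := congrArg Subtype.val h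
    have h' : J * I = J' * I' := by rw [mul_comm, h, mul_comm]
    simp only [Prod.mk.injEq, Subtype.mk.injEq]
    exact ⟨dvd_antisymm (dvd_of_mul_eq_mul_of_coprime_absNorm hmn hI hJ' h)
        (dvd_of_mul_eq_mul_of_coprime_absNorm hmn hI' hJ h.symm),
      dvd_antisymm (dvd_of_mul_eq_mul_of_coprime_absNorm hmn.symm hJ hI' h')
        (dvd_of_mul_eq_mul_of_coprime_absNorm hmn.symm hJ' hI h'.symm)⟩
  · rintro ⟨L, hL⟩
    obtain ⟨I, J, hI, hJ, rfl⟩ := exists_mul_eq_of_absNorm_eq_mul hm hn hmn hL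
    exact ⟨⟨⟨I, hI⟩, ⟨J, hJ⟩⟩, rfl⟩

end

variable (K : Type*) [Field K] [NumberField K]

/-- The number `e` is `1`, `-1` or `0` according to whether `p` is split, inert or ramified
in the quadratic field `K`. -/
def IsSplittingSymbol (p : ℕ) (e : ℂ) : Prop :=
  (e = 1 ∧ ∃ P Q : Ideal (𝓞 K), P ≠ Q ∧ P.IsPrime ∧ Q.IsPrime ∧ span {(p : 𝓞 K)} = P * Q ∧
    absNorm P = p ∧ absNorm Q = p) ∨
  (e = -1 ∧ (span {(p : 𝓞 K)}).IsPrime ∧ absNorm (span {(p : 𝓞 K)}) = p ^ 2) ∨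
  (e = 0 ∧ ∃ P : Ideal (𝓞 K), P.IsPrime ∧ span {(p : 𝓞 K)} = P * P ∧ absNorm P = p)

variable {K}

lemma card_ideal_absNorm_eq_pow_of_split {p : ℕ} (hp : p.Prime) {P Q : Ideal (𝓞 K)} (hPQ : P ≠ Q)
    (hP : P.IsPrime) (hQ : Q.IsPrime) (h : span {(p : 𝓞 K)} = P * Q)
    (hPn : absNorm P = p) (hQn : absNorm Q = p) (k : ℕ) :
    Nat.card {I : Ideal (𝓞 K) // absNorm I = p ^ k} = k + 1 := by
  have hP0 : P ≠ ⊥ := by rintro rfl; simp [hp.ne_zero, eq_comm] at hPn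
  have hQ0 : Q ≠ ⊥ := by rintro rfl; simp [hp.ne_zero, eq_comm] at hQn
  have hPp : Prime P := prime_of_isPrime hP0 hP
  have hQp : Prime Q := prime_of_isPrime hQ0 hQ
  have hcop (i j : ℕ) : IsCoprime (P ^ i) (Q ^ j) := by
    have : IsCoprime P Q := by
      rw [isCoprime_iff_sup_eq]
      exact (hP.isMaximal hP0).coprime_of_ne (hQ.isMaximal hQ0) hPQ
    exact this.pow
  have hle {i j : ℕ} (hij : P ^ i * Q ^ (k - i) = P ^ j * Q ^ (k - j)) : i ≤ j := by
    have h1 : P ^ i ∣ P ^ j := (hcop i (k - j)).dvd_of_dvd_mul_right (hij ▸ dvd_mul_right ..)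
    exact (pow_dvd_pow_iff hPp.ne_zero hPp.not_isUnit).mp h1
  have hbij : Function.Bijective (fun i : Fin (k + 1) ↦
      (⟨P ^ (i : ℕ) * Q ^ (k - i), by
        rw [map_mul, map_pow, map_pow, hPn, hQn, ← pow_add]
        congr 1
        omega⟩ : {I : Ideal (𝓞 K) // absNorm I = p ^ k})) := by
    refine ⟨fun i j hij ↦ ?_, ?_⟩
    · have hij := congrArg Subtype.val hij
      exact Fin.ext ((hle hij).antisymm (hle hij.symm))
    · rintro ⟨I, hI⟩
      have hdvd : I ∣ P ^ k * Q ^ k := by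
        rw [← mul_pow, ← h, span_singleton_pow, ← Nat.cast_pow, ← hI, dvd_iff_le,
          span_singleton_le_iff_mem]
        exact absNorm_mem I
      obtain ⟨I, J, hIP, hJQ, rfl⟩ := exists_dvd_and_dvd_of_dvd_mul hdvd
      obtain ⟨i, hi, hi'⟩ := (dvd_prime_pow hPp _).mp hIP
      obtain ⟨j, hj, hj'⟩ := (dvd_prime_pow hQp _).mp hJQ
      obtain rfl := associated_iff_eq.mp hi'
      obtain rfl := associated_iff_eq.mp hj'
      rw [map_mul, map_pow, map_pow, hPn, hQn, ← pow_add] at hI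
      have hij := Nat.pow_right_injective hp.two_le hI
      refine ⟨⟨i, by omega⟩, Subtype.ext ?_⟩
      simp only
      congr 2
      omega
  rw [← Nat.card_eq_of_bijective _ hbij, Nat.card_fin]

/-- If the only prime above `p` is `P`, then the only ideals of `p`-power norm are powers of `P`. -/
lemma card_ideal_absNorm_eq_pow_of_unique {p : ℕ} (hp : p.Prime) {P : Ideal (𝓞 K)}
    (hP : P.IsPrime) {e f : ℕ} (h : span {(p : 𝓞 K)} = P ^ e) (hf : f ≠ 0)
    (hPn : absNorm P = p ^ f) (k : ℕ) :
    Nat.card {I : Ideal (𝓞 K) // absNorm I = p ^ k} = if f ∣ k then 1 else 0 := by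
  have hP0 : P ≠ ⊥ := by rintro rfl; simp [hp.ne_zero, eq_comm] at hPn
  have hPp : Prime P := prime_of_isPrime hP0 hP
  have key {I : Ideal (𝓞 K)} (hI : absNorm I = p ^ k) : ∃ i, f * i = k ∧ I = P ^ i := by
    have hdvd : I ∣ P ^ (e * k) := by
      rw [pow_mul, ← h, span_singleton_pow, ← Nat.cast_pow, ← hI, dvd_iff_le,
        span_singleton_le_iff_mem]
      exact absNorm_mem I
    obtain ⟨i, -, hi'⟩ := (dvd_prime_pow hPp _).mp hdvd
    obtain rfl := associated_iff_eq.mp hi'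
    rw [map_pow, hPn, ← pow_mul] at hI
    exact ⟨i, Nat.pow_right_injective hp.two_le hI, rfl⟩
  split_ifs with hk
  · obtain ⟨i, rfl⟩ := hk
    rw [Nat.card_eq_one_iff_unique]
    refine ⟨⟨fun ⟨I, hI⟩ ⟨J, hJ⟩ ↦ Subtype.ext ?_⟩, ⟨P ^ i, by rw [map_pow, hPn, pow_mul]⟩⟩
    obtain ⟨a, ha, rfl⟩ := key hI
    obtain ⟨b, hb, rfl⟩ := key hJ
    simp only
    rw [Nat.eq_of_mul_eq_mul_left (Nat.pos_of_ne_zero hf) (ha.trans hb.symm)]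
  · have : IsEmpty {I : Ideal (𝓞 K) // absNorm I = p ^ k} := ⟨fun ⟨I, hI⟩ ↦ by
      obtain ⟨i, rfl, -⟩ := key hI
      exact hk (dvd_mul_right ..)⟩
    exact Nat.card_of_isEmpty

theorem IsSplittingSymbol.card_ideal_absNorm_eq_pow {p : ℕ} (hp : p.Prime) {e : ℂ}
    (h : IsSplittingSymbol K p e) (k : ℕ) :
    (Nat.card {I : Ideal (𝓞 K) // absNorm I = p ^ k} : ℂ) = ∑ i ∈ Finset.range (k + 1), e ^ i := by
  rcases h with ⟨rfl, P, Q, hPQ, hP, hQ, h, hPn, hQn⟩ | ⟨rfl, hP, hPn⟩ | ⟨rfl, P, hP, h, hPn⟩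
  · rw [card_ideal_absNorm_eq_pow_of_split hp hPQ hP hQ h hPn hQn]
    simp
  · rw [card_ideal_absNorm_eq_pow_of_unique hp hP (pow_one _).symm two_ne_zero hPn,
      neg_one_geom_sum]
    simp only [even_iff_two_dvd]
    split_ifs <;> first | omega | simp
  · rw [card_ideal_absNorm_eq_pow_of_unique hp hP (h.trans (sq P).symm) one_ne_zero
      (hPn.trans (pow_one p).symm)]
    simp [zero_geom_sum]

end IdealCount

section ClassNumber

open NumberField Ideal Filter Topology

variable (K : Type*) [Field K] [NumberField K]

/-- The number of integral ideals of given norm, as an arithmetic function. -/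
noncomputable def idealCount : ArithmeticFunction ℂ :=
  ⟨fun n ↦ if n = 0 then 0 else Nat.card {I : Ideal (𝓞 K) // absNorm I = n}, if_pos rfl⟩

variable {K}

lemma idealCount_apply {n : ℕ} (hn : n ≠ 0) :
    idealCount K n = Nat.card {I : Ideal (𝓞 K) // absNorm I = n} := if_neg hn

variable (K) in
lemma isMultiplicative_idealCount : (idealCount K).IsMultiplicative := by
  refine ArithmeticFunction.IsMultiplicative.iff_ne_zero.mpr ⟨?_, fun {m n} hm hn hmn ↦ ?_⟩
  · rw [idealCount_apply one_ne_zero, Nat.cast_eq_one, Nat.card_eq_one_iff_unique]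
    simp only [absNorm_eq_one_iff]
    exact ⟨inferInstance, inferInstance⟩
  · rw [idealCount_apply hm, idealCount_apply hn, idealCount_apply (mul_ne_zero hm hn),
      card_ideal_absNorm_eq_mul K hm hn hmn, Nat.cast_mul]

variable {N : ℕ} {χ : DirichletCharacter ℂ N}

open ArithmeticFunction in
lemma idealCount_eq_zeta_mul (h : ∀ p : ℕ, p.Prime → IsSplittingSymbol K p (χ (p : ZMod N))) :
    idealCount K =
      (ArithmeticFunction.zeta : ArithmeticFunction ℂ) * toArithmeticFunction (fun n : ℕ ↦ χ n) := by
  rw [(isMultiplicative_idealCount K).eq_iff_eq_on_prime_powers _ _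
    (isMultiplicative_zeta.natCast.mul χ.isMultiplicative_toArithmeticFunction)]
  intro p k hp
  rw [idealCount_apply (pow_pos hp.pos k).ne', (h p hp).card_ideal_absNorm_eq_pow hp,
    coe_zeta_mul_apply, Nat.sum_divisors_prime_pow hp]
  refine Finset.sum_congr rfl fun i _ ↦ ?_
  rw [← χ.apply_eq_toArithmeticFunction_apply (pow_pos hp.pos i).ne', Nat.cast_pow, map_pow]

open ArithmeticFunction in
theorem dedekindZeta_eq_riemannZeta_mul_LFunction [NeZero N]
    (h : ∀ p : ℕ, p.Prime → IsSplittingSymbol K p (χ (p : ZMod N))) {s : ℂ} (hs : 1 < s.re) :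
    dedekindZeta K s = riemannZeta s * χ.LFunction s := by
  have h1 : dedekindZeta K s = LSeries (fun n ↦ idealCount K n) s :=
    LSeries_congr (fun {n} hn ↦ (idealCount_apply hn).symm) s
  have h2 : LSeries (fun n ↦ toArithmeticFunction (fun n : ℕ ↦ χ n) n) s =
      LSeries (fun n : ℕ ↦ χ n) s :=
    LSeries_congr (fun {n} hn ↦ (χ.apply_eq_toArithmeticFunction_apply hn).symm) s
  have h3 : LSeriesSummable (fun n ↦ toArithmeticFunction (fun n : ℕ ↦ χ n) n) s :=
    (LSeriesSummable_congr s fun {n} hn ↦ χ.apply_eq_toArithmeticFunction_apply hn).mp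
      (χ.LSeriesSummable_of_one_lt_re hs)
  have h4 : LSeriesSummable (fun n ↦ (ArithmeticFunction.zeta : ArithmeticFunction ℂ) n) s := by
    simpa using LSeriesSummable_zeta_iff.mpr hs
  rw [h1, idealCount_eq_zeta_mul h, LSeries_mul' h4 h3, h2, χ.LFunction_eq_LSeries hs,
    ← LSeries_zeta_eq_riemannZeta hs]
  simp

theorem LFunction_one_eq_dedekindZeta_residue [NeZero N]
    (h : ∀ p : ℕ, p.Prime → IsSplittingSymbol K p (χ (p : ZMod N))) :
    χ.LFunction 1 = dedekindZeta_residue K := by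
  have hcast : Tendsto (fun s : ℝ ↦ (s : ℂ)) (𝓝[>] 1) (𝓝[≠] 1) := by
    refine tendsto_nhdsWithin_iff.mpr ⟨?_, ?_⟩
    · exact (Complex.continuous_ofReal.tendsto 1).mono_left nhdsWithin_le_nhds
    · filter_upwards [self_mem_nhdsWithin] with s hs
      simpa using (show (1 : ℝ) < s from hs).ne'
  have hζ := riemannZeta_residue_one.comp hcast
  have hK := tendsto_sub_one_mul_dedekindZeta_nhdsGT K
  have heq : (fun s : ℝ ↦ (s - 1) * dedekindZeta K s) =ᶠ[𝓝[>] 1]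
      fun s : ℝ ↦ ((s - 1) * riemannZeta s) * χ.LFunction s := by
    filter_upwards [self_mem_nhdsWithin] with s hs
    rw [dedekindZeta_eq_riemannZeta_mul_LFunction h (by simpa using hs), mul_assoc]
  have hK' := hK.congr' heq
  have hχ : χ ≠ 1 := by
    rintro rfl
    have h1 := (DirichletCharacter.LFunctionTrivChar_residue_one (N := N)).comp hcast
    have h2 : Tendsto (fun s : ℝ ↦ (s : ℂ) - 1) (𝓝[>] 1) (𝓝 0) := by
      have := (hcast.mono_right nhdsWithin_le_nhds).sub_const 1
      simpa using this
    have h3 := h2.mul hK'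
    have h4 := hζ.mul h1
    rw [zero_mul] at h3
    rw [one_mul] at h4
    have h5 := tendsto_nhds_unique (h3.congr fun s ↦ by simp only [Function.comp_apply]; ring) h4
    refine Finset.prod_ne_zero_iff.mpr (fun p hp ↦ ?_) h5.symm
    have hp' := Nat.prime_of_mem_primeFactors hp
    rw [sub_ne_zero, ne_comm, Ne, inv_eq_one]
    exact_mod_cast hp'.one_lt.ne'
  have hL : Tendsto (fun s : ℝ ↦ χ.LFunction s) (𝓝[>] 1) (𝓝 (χ.LFunction 1)) :=
    ((DirichletCharacter.differentiable_LFunction hχ).continuous.tendsto 1).comp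
      (hcast.mono_right nhdsWithin_le_nhds)
  have h6 := tendsto_nhds_unique (hζ.mul hL) hK'
  rwa [one_mul] at h6

open NumberField.InfinitePlace NumberField.Units

lemma units_rank_eq_zero (himag : ∀ v : InfinitePlace K, v.IsComplex)
    (hK : Module.finrank ℚ K = 2) : rank K = 0 := by
  have hr : nrRealPlaces K = 0 := nrRealPlaces_eq_zero_iff.mpr ⟨himag⟩
  have := card_add_two_mul_card_eq_rank K
  rw [rank, card_eq_nrRealPlaces_add_nrComplexPlaces]
  omega

lemma torsionOrder_eq_card_units (h : rank K = 0) : torsionOrder K = Nat.card (𝓞 K)ˣ := by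
  have : IsEmpty (Fin (rank K)) := h ▸ inferInstance
  have : torsion K = ⊤ := by
    refine eq_top_iff.mpr fun u _ ↦ ?_
    obtain ⟨⟨x, e⟩, hxu, -⟩ := exist_unique_eq_mul_prod K u
    rw [Finset.univ_eq_empty, Finset.prod_empty, mul_one] at hxu
    exact hxu ▸ x.2
  rw [torsionOrder, this]
  exact Subgroup.card_top

lemma regulator_eq_one (h : rank K = 0) : regulator K = 1 := by
  classical
  have : IsEmpty (Fin (rank K)) := h ▸ inferInstance
  have : IsEmpty {w : InfinitePlace K // w ≠ dirichletUnitTheorem.w₀} :=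
    (equivFinRank (K := K)).symm.isEmpty
  rw [regulator_eq_det', Matrix.det_isEmpty, abs_one]

theorem dedekindZeta_residue_of_isComplex (himag : ∀ v : InfinitePlace K, v.IsComplex)
    (hK : Module.finrank ℚ K = 2) :
    dedekindZeta_residue K =
      2 * Real.pi * Nat.card (ClassGroup (𝓞 K)) / (Nat.card (𝓞 K)ˣ * Real.sqrt |discr K|) := by
  have hr : nrRealPlaces K = 0 := nrRealPlaces_eq_zero_iff.mpr ⟨himag⟩
  have hc : nrComplexPlaces K = 1 := by
    have := card_add_two_mul_card_eq_rank K
    omega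
  have hrank := units_rank_eq_zero himag hK
  rw [dedekindZeta_residue_def, hr, hc, regulator_eq_one hrank, torsionOrder_eq_card_units hrank,
    classNumber, ← Nat.card_eq_fintype_card]
  simp

end ClassNumber

section CardUnits

open NumberField Ideal

section

variable {A B : Type*} [CommRing A] [CommRing B]

/-- The kernel on units of a local homomorphism of rings is in bijection with its kernel. -/
noncomputable def kerUnitsMapEquiv (f : A →+* B) [IsLocalHom f] :
    (Units.map (f : A →* B)).ker ≃ RingHom.ker f where
  toFun u := ⟨u.1 - 1, by
    have := congrArg Units.val (MonoidHom.mem_ker.mp u.2)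
    rw [RingHom.mem_ker, map_sub, map_one, sub_eq_zero]
    exact this⟩
  invFun k := ⟨(isUnit_of_map_unit f (1 + k.1) (by
    rw [map_add, map_one, RingHom.mem_ker.mp k.2, add_zero]
    exact isUnit_one)).unit, by
      rw [MonoidHom.mem_ker]
      ext
      simp [RingHom.mem_ker.mp k.2]⟩
  left_inv u := by
    ext
    simp
  right_inv k := by
    ext
    simp

lemma card_units_mul_card_of_surjective {f : A →+* B} [IsLocalHom f]
    (hf : Function.Surjective f) :
    Nat.card Aˣ * Nat.card B = Nat.card Bˣ * Nat.card A := by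
  have hsurj : Function.Surjective (Units.map (f : A →* B)) := fun u ↦ by
    obtain ⟨a, ha⟩ := hf u
    exact ⟨(isUnit_of_map_unit f a (ha ▸ u.isUnit)).unit, Units.ext ha⟩
  have h1 := Subgroup.card_eq_card_quotient_mul_card_subgroup (Units.map (f : A →* B)).ker
  rw [Nat.card_congr (QuotientGroup.quotientKerEquivOfSurjective _ hsurj).toEquiv,
    Nat.card_congr (kerUnitsMapEquiv f)] at h1
  have h2 := AddSubgroup.card_eq_card_quotient_mul_card_addSubgroup (f : A →+ B).ker
  rw [Nat.card_congr (QuotientAddGroup.quotientKerEquivOfSurjective (f : A →+ B) hf).toEquiv] at h2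
  rw [h1, h2, mul_assoc, mul_comm (Nat.card B)]
  rfl

lemma card_units_quotient_mul_of_le_of_pow_le {I J : Ideal A} (h : I ≤ J) {n : ℕ}
    (hn : J ^ n ≤ I) :
    Nat.card (A ⧸ I)ˣ * Nat.card (A ⧸ J) = Nat.card (A ⧸ J)ˣ * Nat.card (A ⧸ I) := by
  have : IsLocalHom (Ideal.Quotient.factor h) := ⟨fun a ha ↦ by
    have hnil : IsNilpotent (J.map (Ideal.Quotient.mk I)) := ⟨n, by
      rw [← Ideal.map_pow, Ideal.zero_eq_bot, Ideal.map_eq_bot_iff_le_ker, Ideal.mk_ker]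
      exact hn⟩
    rw [← hnil.isUnit_quotient_mk_iff]
    obtain ⟨a, rfl⟩ := Ideal.Quotient.mk_surjective a
    rw [Ideal.Quotient.factor_mk] at ha
    have h' : J ≤ (J.map (Ideal.Quotient.mk I)).comap (Ideal.Quotient.mk I) := Ideal.le_comap_map
    simpa using ha.map (Ideal.quotientMap _ (Ideal.Quotient.mk I) h')⟩
  exact card_units_mul_card_of_surjective (Ideal.Quotient.factor_surjective h)

lemma card_units_quotient_mul_of_isCoprime {I J : Ideal A} (h : IsCoprime I J) :
    Nat.card (A ⧸ I * J)ˣ = Nat.card (A ⧸ I)ˣ * Nat.card (A ⧸ J)ˣ := by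
  rw [← Nat.card_prod]
  exact Nat.card_congr ((Units.mapEquiv
    (Ideal.quotientMulEquivQuotientProd I J h).toMulEquiv).trans MulEquiv.prodUnits).toEquiv

end

variable {K : Type*} [Field K] [NumberField K]

lemma card_units_quotient_of_isPrime {P : Ideal (𝓞 K)} (hP : P.IsPrime) (h0 : P ≠ ⊥) :
    Nat.card (𝓞 K ⧸ P)ˣ = absNorm P - 1 := by
  have : P.IsMaximal := hP.isMaximal h0
  let := Ideal.Quotient.field P
  rw [Nat.card_units]
  rfl

lemma IsSplittingSymbol.card_units_quotient {p : ℕ} (hp : p.Prime) {e : ℂ}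
    (h : IsSplittingSymbol K p e) :
    (Nat.card (𝓞 K ⧸ span {(p : 𝓞 K)})ˣ : ℂ) = (p - 1) * (p - e) := by
  have hne {P : Ideal (𝓞 K)} (hP : absNorm P = p) : P ≠ ⊥ := fun h ↦ by
    rw [h, absNorm_bot] at hP
    exact hp.ne_zero hP.symm
  have h1 := hp.one_le
  rcases h with ⟨rfl, P, Q, hPQ, hP, hQ, h, hNP, hNQ⟩ | ⟨rfl, hP, hN⟩ | ⟨rfl, P, hP, h, hN⟩
  · have := hP.isMaximal (hne hNP)
    have := hQ.isMaximal (hne hNQ)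
    rw [h, card_units_quotient_mul_of_isCoprime (isCoprime_of_isMaximal hPQ),
      card_units_quotient_of_isPrime hP (hne hNP), card_units_quotient_of_isPrime hQ (hne hNQ),
      hNP, hNQ]
    push_cast [h1]
    ring
  · rw [card_units_quotient_of_isPrime hP, hN, Nat.cast_sub (Nat.one_le_pow _ _ hp.pos)]
    · push_cast
      ring
    · rw [Ne, span_singleton_eq_bot]
      exact_mod_cast hp.ne_zero
  · have h2 := card_units_quotient_mul_of_le_of_pow_le (I := P * P) Ideal.mul_le_left
      (n := 2) (pow_two P).le
    rw [card_units_quotient_of_isPrime hP (hne hN)] at h2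
    change _ * absNorm P = _ * absNorm (P * P) at h2
    rw [map_mul, hN] at h2
    have h3 : Nat.card (𝓞 K ⧸ P * P)ˣ = (p - 1) * p :=
      Nat.eq_of_mul_eq_mul_right hp.pos (by rw [h2, mul_assoc])
    rw [h, h3]
    push_cast [h1]
    ring

theorem card_units_quotient_span_natCast (hK : Module.finrank ℚ K = 2) {χ : ℕ → ℂ}
    (h : ∀ p : ℕ, p.Prime → IsSplittingSymbol K p (χ p)) {c : ℕ} (hc : 0 < c) :
    (Nat.card (𝓞 K ⧸ span {(c : 𝓞 K)})ˣ : ℂ) =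
      c ^ 2 * ∏ p ∈ c.primeFactors, (1 - (p : ℂ)⁻¹) * (1 - χ p * (p : ℂ)⁻¹) := by
  have hN (n : ℕ) : Nat.card (𝓞 K ⧸ span {(n : 𝓞 K)}) = n ^ 2 := by
    change absNorm _ = _
    rw [absNorm_span_natCast, RingOfIntegers.rank, hK]
  induction c using Nat.recOnPosPrimePosCoprime with
  | zero => exact absurd hc (lt_irrefl 0)
  | one =>
    have : Subsingleton (𝓞 K ⧸ span {((1 : ℕ) : 𝓞 K)}) := by
      rw [Nat.cast_one, span_singleton_one]
      infer_instance
    simp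
  | prime_pow p n hp hn =>
    have hp0 : (p : ℂ) ≠ 0 := by exact_mod_cast hp.ne_zero
    have h1 := card_units_quotient_mul_of_le_of_pow_le (I := span {((p ^ n : ℕ) : 𝓞 K)})
      (J := span {(p : 𝓞 K)}) (n := n)
      (by rw [Nat.cast_pow, span_singleton_le_span_singleton]; exact dvd_pow_self _ hn.ne')
      (by rw [span_singleton_pow, Nat.cast_pow])
    rw [hN, hN] at h1
    have h2 : (_ : ℂ) = _ := congrArg Nat.cast h1
    push_cast at h2
    rw [(h p hp).card_units_quotient hp] at h2
    rw [Nat.primeFactors_prime_pow hn.ne' hp, Finset.prod_singleton]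
    refine mul_right_cancel₀ (pow_ne_zero 2 hp0) ?_
    push_cast
    rw [h2]
    field_simp
  | coprime a b ha hb hab iha ihb =>
    have hcop : IsCoprime (span {(a : 𝓞 K)}) (span {(b : 𝓞 K)}) := by
      rw [isCoprime_span_singleton_iff]
      exact hab.cast
    rw [Nat.cast_mul, ← span_singleton_mul_span_singleton,
      card_units_quotient_mul_of_isCoprime hcop, Nat.cast_mul, iha (by omega), ihb (by omega),
      hab.primeFactors_mul, Finset.prod_union hab.disjoint_primeFactors]
    push_cast
    ring

end CardUnits

section Assembly

open Ideal

lemma isSplittingSymbol_of_dirichletCharacter {K : Type*} [Field K] [NumberField K]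
    (hK : Module.finrank ℚ K = 2)
    (χ : DirichletCharacter ℂ (discr K).natAbs)
    (hχ : ∀ p : ℕ, p.Prime → ¬ ((p : ℤ) ∣ discr K) →
      ((∃ P Q : Ideal (𝓞 K), P ≠ Q ∧ P.IsPrime ∧ Q.IsPrime ∧
          Ideal.span {(p : 𝓞 K)} = P * Q) → χ (p : ZMod (discr K).natAbs) = 1) ∧
      ((Ideal.span {(p : 𝓞 K)}).IsPrime → χ (p : ZMod (discr K).natAbs) = -1))
    {p : ℕ} (hp : p.Prime) : IsSplittingSymbol K p (χ p) := by
  rcases natCast_prime_trichotomy hK hp with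
    ⟨⟨P, Q, hPQ, hP, hQ, h, hN⟩, hd⟩ | ⟨hP, hN, hd⟩ | ⟨h, hd⟩
  · exact .inl ⟨(hχ p hp hd).1 ⟨P, Q, hPQ, hP, hQ, h⟩, P, Q, hPQ, hP, hQ, h, hN⟩
  · exact .inr (.inl ⟨(hχ p hp hd).2 hP, hP, hN⟩)
  · refine .inr (.inr ⟨χ.map_nonunit ?_, h⟩)
    rw [ZMod.isUnit_iff_coprime, hp.coprime_iff_not_dvd, not_not]
    exact Int.natCast_dvd.mp hd

variable {K : Type*} [Field K] {c : ℕ} {R : Subring K}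

lemma isIntegral_of_mem_order (hR : (R : Set K) = {x : K | ∃ (m : ℤ) (y : 𝓞 K),
    x = (m : K) + (c : K) * algebraMap (𝓞 K) K y}) (x : R) : IsIntegral ℤ (x : K) := by
  obtain ⟨m, y, hxy⟩ : (x : K) ∈ {x : K | ∃ (m : ℤ) (y : 𝓞 K),
    x = (m : K) + (c : K) * algebraMap (𝓞 K) K y} := hR ▸ x.2
  have h : (x : K) = algebraMap (𝓞 K) K (m + c * y) := by simp [hxy]
  rw [h]
  exact RingOfIntegers.isIntegral_coe _

/-- The inclusion of the order `ℤ + c𝓞` into the ring of integers. -/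
def orderInclusion (hR : (R : Set K) = {x : K | ∃ (m : ℤ) (y : 𝓞 K),
    x = (m : K) + (c : K) * algebraMap (𝓞 K) K y}) : R →+* 𝓞 K :=
  R.subtype.codRestrict (integralClosure ℤ K) (isIntegral_of_mem_order hR)

variable (hR : (R : Set K) = {x : K | ∃ (m : ℤ) (y : 𝓞 K),
  x = (m : K) + (c : K) * algebraMap (𝓞 K) K y})

lemma algebraMap_orderInclusion (x : R) : algebraMap (𝓞 K) K (orderInclusion hR x) = x := rfl

lemma orderInclusion_injective : Function.Injective (orderInclusion hR) := fun _ _ h ↦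
  Subtype.ext (congrArg (algebraMap (𝓞 K) K) h)

lemma mem_range_orderInclusion {y : 𝓞 K} (hy : y ∈ span {(c : 𝓞 K)}) :
    y ∈ (orderInclusion hR).range := by
  obtain ⟨z, rfl⟩ := mem_span_singleton.mp hy
  have h : (c : K) * algebraMap (𝓞 K) K z ∈ (R : Set K) := hR ▸ ⟨0, z, by simp⟩
  refine ⟨⟨_, h⟩, RingOfIntegers.coe_injective ?_⟩
  rw [algebraMap_orderInclusion]
  simp

lemma card_units_order_quotient [NumberField K] (hc : 0 < c) :
    Nat.card (R ⧸ (span {(c : 𝓞 K)}).comap (orderInclusion hR))ˣ = c.totient := by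
  have : NeZero c := ⟨hc.ne'⟩
  set I := (span {(c : 𝓞 K)}).comap (orderInclusion hR) with hI
  have hmem (m : ℤ) : (m : R) ∈ I ↔ (c : ℤ) ∣ m := by
    rw [hI, mem_comap, map_intCast, mem_span_singleton]
    constructor
    · rintro ⟨y, hy⟩
      have h : algebraMap ℚ K (m / c) = algebraMap (𝓞 K) K y := by
        rw [map_div₀, div_eq_iff (by simpa using hc.ne')]
        simpa [mul_comm] using congrArg (algebraMap (𝓞 K) K) hy
      have hquot : IsIntegral ℤ (m / c : ℚ) := by
        rw [← isIntegral_algebraMap_iff (algebraMap ℚ K).injective, h]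
        exact RingOfIntegers.isIntegral_coe _
      obtain ⟨k, hk⟩ := IsIntegrallyClosed.isIntegral_iff.mp hquot
      refine ⟨k, ?_⟩
      rw [eq_div_iff (by exact_mod_cast hc.ne')] at hk
      rw [mul_comm]
      rw [eq_intCast] at hk
      exact_mod_cast hk.symm
    · rintro ⟨k, rfl⟩
      exact ⟨k, by simp⟩
  have : CharP (R ⧸ I) c := ⟨fun n ↦ by
    rw [← Int.natCast_dvd_natCast, ← hmem, ← Ideal.Quotient.eq_zero_iff_mem]
    simp⟩
  have hsurj : Function.Surjective (ZMod.castHom dvd_rfl (R ⧸ I) : ZMod c →+* R ⧸ I) := by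
    intro x
    obtain ⟨x, rfl⟩ := Ideal.Quotient.mk_surjective x
    obtain ⟨m, y, hxy⟩ : (x : K) ∈ {x : K | ∃ (m : ℤ) (y : 𝓞 K),
      x = (m : K) + (c : K) * algebraMap (𝓞 K) K y} := hR ▸ x.2
    refine ⟨m, ?_⟩
    rw [map_intCast, eq_comm, ← map_intCast (Ideal.Quotient.mk I),
      Ideal.Quotient.mk_eq_mk_iff_sub_mem, hI, mem_comap, mem_span_singleton]
    refine ⟨y, RingOfIntegers.coe_injective ?_⟩
    rw [algebraMap_orderInclusion]
    simp [hxy]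
  rw [← Nat.card_congr (Units.mapEquiv (RingEquiv.ofBijective _
    ⟨ZMod.castHom_injective (R ⧸ I), hsurj⟩).toMulEquiv).toEquiv, Nat.card_eq_fintype_card,
    ZMod.card_units_eq_totient]

end Assembly

theorem class_number_of_order_via_L_value
    (K : Type*) [Field K] [NumberField K]
    (himag : ∀ v : NumberField.InfinitePlace K, v.IsComplex)
    (hdeg : Module.finrank ℚ K = 2)
    (D : ℤ) (hDdef : D = NumberField.discr K) (hD : D < 0)
    (χ : DirichletCharacter ℂ D.natAbs) (hχ2 : χ ^ 2 = 1)
    -- `χ(p) = 1` for `p` split, `χ(p) = -1` for `p` inert (`p ∤ D`)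
    (hχsplit : ∀ p : ℕ, p.Prime → ¬ ((p : ℤ) ∣ D) →
      ((∃ P Q : Ideal (𝓞 K), P ≠ Q ∧ P.IsPrime ∧ Q.IsPrime ∧
          Ideal.span {(p : 𝓞 K)} = P * Q) → χ (p : ZMod D.natAbs) = 1) ∧
      ((Ideal.span {(p : 𝓞 K)}).IsPrime → χ (p : ZMod D.natAbs) = -1)) :
    letI : NeZero D.natAbs := ⟨Int.natAbs_ne_zero.mpr (by omega)⟩
    ∀ c : ℕ, 1 ≤ c → ∀ R : Subring K,
      -- `R` is the order `𝒪_c = ℤ + c𝒪_K`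
      ((R : Set K) = {x : K | ∃ (m : ℤ) (y : 𝓞 K),
        x = (m : K) + (c : K) * algebraMap (𝓞 K) K y}) →
      (Nat.card (ClassGroup ↥R) : ℂ) =
        (Nat.card (↥R)ˣ : ℂ) / (2 * (Real.pi : ℂ)) * c *
          (Real.sqrt |(D : ℝ)| : ℂ) * DirichletCharacter.LFunction χ 1 *
          ∏ p ∈ c.primeFactors, (1 - χ (p : ZMod D.natAbs) * (p : ℂ)⁻¹) := by
  intro c hc R hR
  have : NeZero D.natAbs := ⟨Int.natAbs_ne_zero.mpr hD.ne⟩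
  subst hDdef
  have hsplit (p : ℕ) (hp : p.Prime) := isSplittingSymbol_of_dirichletCharacter hdeg χ hχsplit hp
  let := (orderInclusion hR).toAlgebra
  have : FaithfulSMul R (𝓞 K) :=
    (faithfulSMul_iff_algebraMap_injective R (𝓞 K)).mpr (orderInclusion_injective hR)
  have hc0 : (c : 𝓞 K) ≠ 0 := by exact_mod_cast (Nat.pos_of_ne_zero (by omega)).ne'
  have hspan : Ideal.span {(c : 𝓞 K)} ≠ ⊥ := by
    rwa [Ne, Ideal.span_singleton_eq_bot]
  have : Finite (𝓞 K ⧸ Ideal.span {(c : 𝓞 K)}) := Ideal.finiteQuotientOfFreeOfNeBot _ hspan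
  have h1 := card_classGroup_mul_card_units (fun _ ↦ mem_range_orderInclusion hR) hspan
  rw [RingHom.algebraMap_toAlgebra, card_units_order_quotient hR hc] at h1
  have h1 : (_ : ℂ) = _ := congrArg Nat.cast h1
  push_cast at h1
  have h2 : (c.totient : ℂ) = c * ∏ p ∈ c.primeFactors, (1 - (p : ℂ)⁻¹) := by
    have := congrArg (Rat.cast : ℚ → ℂ) (Nat.totient_eq_mul_prod_factors c)
    push_cast at this
    exact this
  have h3 := card_units_quotient_span_natCast hdeg hsplit hc
  have h4 := LFunction_one_eq_dedekindZeta_residue hsplit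
  rw [dedekindZeta_residue_of_isComplex himag hdeg] at h4
  have hφ : (c.totient : ℂ) ≠ 0 := by exact_mod_cast (Nat.totient_pos.mpr hc).ne'
  have hw : (Nat.card (𝓞 K)ˣ : ℂ) ≠ 0 := by
    rw [← torsionOrder_eq_card_units (units_rank_eq_zero himag hdeg)]
    exact_mod_cast Units.torsionOrder_ne_zero K
  have hs : (Real.sqrt |(discr K : ℝ)| : ℂ) ≠ 0 := by
    rw [Complex.ofReal_ne_zero, Real.sqrt_ne_zero', abs_pos]
    exact_mod_cast hD.ne
  have hπ : (Real.pi : ℂ) ≠ 0 := by exact_mod_cast Real.pi_ne_zero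
  rw [Finset.prod_mul_distrib] at h3
  refine mul_right_cancel₀ (mul_ne_zero hw hφ) ?_
  rw [← mul_assoc, h1, h3, h4, h2]
  push_cast
  field_simp
end

section
/- Let K be an imaginary quadratic field of discriminant D, and let N ≥ 1, c ≥ 1, and a, b be integers with a² − 4Nb = Dc². Then: (i) the entries (Dc² ± a)/2 are integers, and there is a unique ℚ-algebra homomorphism ι : K → M₂(ℚ) sending (Dc² + c√D)/2 to the matrix [[(Dc²+a)/2, −1], [Nb, (Dc²−a)/2]]; (ii) the preimage under ι of the Eichler order R = {[[x,y],[z,w]] ∈ M₂(ℤ) : N | z} is exactly the order ℤ + c𝒪_K of conductor c in K. -/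
open NumberField

open Module

section
variable {K : Type*} [Field K] [NumberField K] {D : ℤ} {s : K}

theorem discr_neg_of_isTotallyComplex_of_finrank_eq_two
    (himag : ∀ v : InfinitePlace K, v.IsComplex) (hdeg : finrank ℚ K = 2) :
    discr K < 0 := by
  have : IsTotallyComplex K := ⟨himag⟩
  have h := IsTotallyComplex.finrank (K := K)
  have h1 : InfinitePlace.nrComplexPlaces K = 1 := by omega
  have h2 := sign_discr K
  rw [h1, pow_one] at h2
  exact Int.sign_eq_neg_one_iff_neg.mp h2

theorem ratCast_ne_of_sq_eq_of_neg (hs : s ^ 2 = (D : K)) (hD : D < 0) (q : ℚ) : (q : K) ≠ s := by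
  rintro rfl
  have h : q ^ 2 = (D : ℚ) := by exact_mod_cast hs
  have : (D : ℚ) < 0 := by exact_mod_cast hD
  nlinarith [sq_nonneg q]

/-- The `ℚ`-basis `1, s` of a quadratic field, for `s` irrational. -/
theorem exists_basis_one_sqrt (hdeg : finrank ℚ K = 2) (hirr : ∀ q : ℚ, (q : K) ≠ s) :
    ∃ B : Basis (Fin 2) ℚ K, B 0 = 1 ∧ B 1 = s := by
  have hli : LinearIndependent ℚ ![1, s] := by
    rw [LinearIndependent.pair_iff' one_ne_zero]
    intro q
    simpa [Rat.smul_def] using hirr q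
  exact ⟨basisOfLinearIndependentOfCardEqFinrank hli (by simp [hdeg]), by simp, by simp⟩

theorem exists_rat_add_rat_mul_sqrt (hdeg : finrank ℚ K = 2) (hirr : ∀ q : ℚ, (q : K) ≠ s)
    (x : K) : ∃ u v : ℚ, x = u + v * s := by
  obtain ⟨B, h0, h1⟩ := exists_basis_one_sqrt hdeg hirr
  refine ⟨B.repr x 0, B.repr x 1, ?_⟩
  conv_lhs => rw [← B.sum_repr x]
  simp [h0, h1, Rat.smul_def]

theorem rat_add_rat_mul_sqrt_inj (hirr : ∀ q : ℚ, (q : K) ≠ s) {u v u' v' : ℚ}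
    (h : (u : K) + v * s = u' + v' * s) : u = u' ∧ v = v' := by
  have hv : v = v' := by
    by_contra hne
    have hne' : (v : K) - v' ≠ 0 := sub_ne_zero.mpr (by exact_mod_cast hne)
    apply hirr ((u' - u) / (v - v'))
    push_cast
    rw [div_eq_iff hne']
    linear_combination -h
  subst hv
  exact ⟨by exact_mod_cast add_right_cancel h, rfl⟩

theorem trace_rat_add_rat_mul_sqrt (hdeg : finrank ℚ K = 2) (hirr : ∀ q : ℚ, (q : K) ≠ s)
    (hs : s ^ 2 = (D : K)) (u v : ℚ) : Algebra.trace ℚ K (u + v * s) = 2 * u := by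
  obtain ⟨B, h0, h1⟩ := exists_basis_one_sqrt hdeg hirr
  have hts : Algebra.trace ℚ K s = 0 := by
    rw [Algebra.trace_eq_matrix_trace B, Matrix.trace_fin_two,
      Algebra.leftMulMatrix_eq_repr_mul, Algebra.leftMulMatrix_eq_repr_mul, h0, h1, mul_one,
      ← sq, hs]
    have hD : (D : K) = (D : ℚ) • B 0 := by simp [h0, Rat.smul_def]
    rw [hD, ← h1]
    simp
  have hu : Algebra.trace ℚ K (u : K) = 2 * u := by
    rw [← eq_ratCast (algebraMap ℚ K) u, Algebra.trace_algebraMap, hdeg, nsmul_eq_mul]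
    norm_num
  rw [map_add, hu, ← Rat.smul_def, map_smul, hts]
  simp

theorem exists_integralBasis_coords (hdeg : finrank ℚ K = 2) (hirr : ∀ q : ℚ, (q : K) ≠ s)
    (hs : s ^ 2 = (D : K)) (hD : D = discr K) :
    ∃ (e : Basis (Fin 2) ℤ (𝓞 K)) (u v : Fin 2 → ℚ),
      (∀ i, (e i : K) = u i + v i * s) ∧ (2 * (u 0 * v 1 - u 1 * v 0)) ^ 2 = 1 := by
  have hr : finrank ℤ (𝓞 K) = 2 := by rw [RingOfIntegers.rank, hdeg]
  let e : Basis (Fin 2) ℤ (𝓞 K) := finBasisOfFinrankEq ℤ (𝓞 K) hr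
  choose u v huv using fun i => exists_rat_add_rat_mul_sqrt hdeg hirr (e i : K)
  refine ⟨e, u, v, huv, ?_⟩
  have hd := discr_eq_discr K e
  rw [← hD, Algebra.discr_def, Matrix.det_fin_two] at hd
  have htr : ∀ i j, ((Algebra.trace ℤ (𝓞 K) (e i * e j) : ℤ) : ℚ) =
      2 * (u i * u j + D * (v i * v j)) := by
    intro i j
    rw [Algebra.coe_trace_int, ← trace_rat_add_rat_mul_sqrt hdeg hirr hs _ (u i * v j + u j * v i)]
    congr 1
    rw [RingOfIntegers.coe_eq_algebraMap, map_mul, ← RingOfIntegers.coe_eq_algebraMap,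
      ← RingOfIntegers.coe_eq_algebraMap, huv, huv]
    push_cast
    linear_combination (v i * v j : K) * hs
  replace hd := congrArg (Int.cast : ℤ → ℚ) hd
  simp only [Algebra.traceMatrix_apply, Algebra.traceForm_apply] at hd
  push_cast [htr] at hd
  have hD0 : (D : ℚ) ≠ 0 := by
    rw [hD]
    exact_mod_cast discr_ne_zero K
  apply mul_left_cancel₀ hD0
  linear_combination hd

theorem exists_int_coords_of_ringOfIntegers (hdeg : finrank ℚ K = 2)
    (hirr : ∀ q : ℚ, (q : K) ≠ s) (hs : s ^ 2 = (D : K)) (hD : D = discr K)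
    (x : 𝓞 K) {p q : ℚ} (hx : (x : K) = p + q * s) :
    ∃ t k : ℤ, 2 * p = t ∧ 2 * q = k ∧ 4 ∣ t ^ 2 - D * k ^ 2 := by
  obtain ⟨e, u, v, huv, hdet⟩ := exists_integralBasis_coords hdeg hirr hs hD
  have hcoord : ∀ y : 𝓞 K, (y : K) =
      ((e.repr y 0 * u 0 + e.repr y 1 * u 1 : ℚ) : K) +
        (e.repr y 0 * v 0 + e.repr y 1 * v 1 : ℚ) * s := by
    intro y
    conv_lhs => rw [← e.sum_repr y]
    rw [Fin.sum_univ_two, RingOfIntegers.coe_eq_algebraMap, map_add, map_zsmul, map_zsmul,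
      ← RingOfIntegers.coe_eq_algebraMap, ← RingOfIntegers.coe_eq_algebraMap, huv, huv]
    simp only [zsmul_eq_mul]
    push_cast
    ring
  obtain ⟨hp, hq⟩ := rat_add_rat_mul_sqrt_inj hirr (hx.symm.trans (hcoord x))
  have hone : ((1 : ℚ) : K) + (0 : ℚ) * s = ((1 : 𝓞 K) : K) := by simp
  obtain ⟨h1, h0⟩ := rat_add_rat_mul_sqrt_inj hirr (hone.trans (hcoord 1))
  have ht : Algebra.trace ℚ K x = 2 * p := by
    rw [hx, trace_rat_add_rat_mul_sqrt hdeg hirr hs]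
  rw [← Algebra.coe_trace_int] at ht
  set t := Algebra.trace ℤ (𝓞 K) x
  have hk : ∃ k : ℤ, 2 * q = k := by
    have hq2 : 2 * q = 2 * (u 0 * v 1 - u 1 * v 0) *
        (e.repr 1 0 * e.repr x 1 - e.repr 1 1 * e.repr x 0) := by
      linear_combination 2 * hq + 2 * (e.repr x 0 * v 0 + e.repr x 1 * v 1) * h1 -
        2 * (e.repr x 0 * u 0 + e.repr x 1 * u 1) * h0
    rcases mul_self_eq_one_iff.mp ((sq _).symm.trans hdet) with h | h <;> rw [h] at hq2
    · exact ⟨e.repr 1 0 * e.repr x 1 - e.repr 1 1 * e.repr x 0, by rw [hq2]; push_cast; ring⟩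
    · exact ⟨-(e.repr 1 0 * e.repr x 1 - e.repr 1 1 * e.repr x 0), by rw [hq2]; push_cast; ring⟩
  obtain ⟨k, hk⟩ := hk
  refine ⟨t, k, ht.symm, hk, ?_⟩
  have hn : IsIntegral ℤ (p ^ 2 - D * q ^ 2) := by
    have hint : IsIntegral ℤ ((t : 𝓞 K) * x - x ^ 2 : 𝓞 K) := Algebra.IsIntegral.isIntegral _
    have hint' := hint.map (IsScalarTower.toAlgHom ℤ (𝓞 K) K)
    have heq : IsScalarTower.toAlgHom ℤ (𝓞 K) K ((t : 𝓞 K) * x - x ^ 2 : 𝓞 K) =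
        algebraMap ℚ K (p ^ 2 - D * q ^ 2) := by
      have ht' : (t : K) = 2 * p := by exact_mod_cast congrArg (Rat.cast : ℚ → K) ht
      simp only [IsScalarTower.coe_toAlgHom', map_sub, map_mul, map_pow, map_intCast, eq_ratCast]
      rw [← RingOfIntegers.coe_eq_algebraMap, hx, ht']
      linear_combination (-(q : K) ^ 2) * hs
    rw [heq] at hint'
    exact (isIntegral_algebraMap_iff (algebraMap ℚ K).injective).mp hint'
  obtain ⟨n, hn⟩ := IsIntegrallyClosed.isIntegral_iff.mp hn
  refine ⟨n, ?_⟩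
  have hn' : (n : ℚ) = p ^ 2 - D * q ^ 2 := by simpa using hn
  have : ((t ^ 2 - D * k ^ 2 : ℤ) : ℚ) = ((4 * n : ℤ) : ℚ) := by
    push_cast
    rw [hn', ht, ← hk]
    ring
  exact_mod_cast this

theorem int_even_sub_mul_of_four_dvd {t k : ℤ} (h : 4 ∣ t ^ 2 - D * k ^ 2) :
    Even (t - D * k) := by
  have h2 : Even (t ^ 2 - D * k ^ 2) := even_iff_two_dvd.mpr (Dvd.dvd.trans (by norm_num) h)
  simpa [Int.even_sub, Int.even_mul, Int.even_pow] using h2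

theorem four_dvd_sq_sub_self_of_discr (hdeg : finrank ℚ K = 2)
    (hirr : ∀ q : ℚ, (q : K) ≠ s) (hs : s ^ 2 = (D : K)) (hD : D = discr K) :
    4 ∣ D ^ 2 - D := by
  obtain ⟨e, u, v, huv, hdet⟩ := exists_integralBasis_coords hdeg hirr hs hD
  choose t k ht hk hdvd using fun i =>
    exists_int_coords_of_ringOfIntegers hdeg hirr hs hD (e i) (huv i)
  have hdet' : (t 0 * k 1 - t 1 * k 0) ^ 2 = 4 := by
    have : (((t 0 * k 1 - t 1 * k 0) ^ 2 : ℤ) : ℚ) = ((4 : ℤ) : ℚ) := by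
      push_cast
      rw [← ht, ← ht, ← hk, ← hk]
      linear_combination 4 * hdet
    exact_mod_cast this
  have hodd : ∀ i, Odd (k i) → 4 ∣ D ^ 2 - D := by
    rintro i ⟨m, hm⟩
    have h := hdvd i
    rw [hm] at h
    have h1 : 4 ∣ (t i) ^ 2 - D := by
      obtain ⟨w, hw⟩ := h
      exact ⟨w + D * (m ^ 2 + m), by linear_combination hw⟩
    obtain ⟨w, hw⟩ := h1
    obtain ⟨r, hr⟩ := Int.even_or_odd' (t i)
    rcases hr with hr | hr <;> rw [hr] at hw
    · obtain rfl : D = 4 * (r ^ 2 - w) := by linear_combination -hw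
      exact ⟨(r ^ 2 - w) * (4 * (r ^ 2 - w) - 1), by ring⟩
    · obtain rfl : D = 4 * (r ^ 2 + r - w) + 1 := by linear_combination -hw
      exact ⟨(r ^ 2 + r - w) * (4 * (r ^ 2 + r - w) + 1), by ring⟩
  by_contra hcon
  have heven : ∀ i, Even (k i) ∧ Even (t i) := by
    intro i
    have hki : Even (k i) := Int.not_odd_iff_even.mp fun h => hcon (hodd i h)
    refine ⟨hki, ?_⟩
    have h := (int_even_sub_mul_of_four_dvd (hdvd i)).add (hki.mul_left D)
    simpa using h
  obtain ⟨⟨k0, hk0⟩, t0, ht0⟩ := heven 0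
  obtain ⟨⟨k1, hk1⟩, t1, ht1⟩ := heven 1
  rw [hk0, ht0, hk1, ht1] at hdet'
  have h16 : 4 * (t0 * k1 - t1 * k0) ^ 2 = 1 := by linarith
  omega

theorem exists_eq_int_add_int_mul_of_ringOfIntegers (hdeg : finrank ℚ K = 2)
    (hirr : ∀ q : ℚ, (q : K) ≠ s) (hs : s ^ 2 = (D : K)) (hD : D = discr K) (x : 𝓞 K) :
    ∃ n j : ℤ, (x : K) = n + j * ((D + s) / 2) := by
  obtain ⟨p, q, hx⟩ := exists_rat_add_rat_mul_sqrt hdeg hirr (x : K)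
  obtain ⟨t, k, ht, hk, hdvd⟩ := exists_int_coords_of_ringOfIntegers hdeg hirr hs hD x hx
  obtain ⟨n, hn⟩ := int_even_sub_mul_of_four_dvd hdvd
  refine ⟨n, k, ?_⟩
  have ht' : 2 * (p : K) = t := by exact_mod_cast congrArg (Rat.cast : ℚ → K) ht
  have hk' : 2 * (q : K) = k := by exact_mod_cast congrArg (Rat.cast : ℚ → K) hk
  have hn' : (t : K) - D * k = n + n := by exact_mod_cast congrArg (Int.cast : ℤ → K) hn
  rw [hx]
  linear_combination (ht' + s * hk' + hn') / 2

theorem isIntegral_discr_add_sqrt_div_two (hs : s ^ 2 = (D : K)) (hD : 4 ∣ D ^ 2 - D) :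
    IsIntegral ℤ (((D : K) + s) / 2) := by
  obtain ⟨m, hm⟩ := hD
  have hm' : (D : K) ^ 2 - D = 4 * m := by exact_mod_cast congrArg (Int.cast : ℤ → K) hm
  refine ⟨Polynomial.X ^ 2 - Polynomial.C D * Polynomial.X + Polynomial.C m, ?_, ?_⟩
  · monicity!
  · simp only [Polynomial.eval₂_add, Polynomial.eval₂_sub, Polynomial.eval₂_mul,
      Polynomial.eval₂_X_pow, Polynomial.eval₂_C, Polynomial.eval₂_X,
      algebraMap_int_eq, Int.coe_castRingHom]
    linear_combination hs / 4 - hm' / 4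

/-- The embedding determined by sending a square root of `D` to a square root of `D`. -/
theorem exists_algHom_of_sq_eq {A : Type*} [Ring A] [Algebra ℚ A] (hdeg : finrank ℚ K = 2)
    (hirr : ∀ q : ℚ, (q : K) ≠ s) (hs : s ^ 2 = (D : K)) (M : A)
    (hM : M * M = (D : ℚ) • 1) : ∃ f : K →ₐ[ℚ] A, f s = M := by
  obtain ⟨B, h0, h1⟩ := exists_basis_one_sqrt hdeg hirr
  let f : K →ₗ[ℚ] A := B.constr ℚ ![1, M]
  have hf1 : f 1 = 1 := by rw [← h0]; simp [f]
  have hfs : f s = M := by rw [← h1]; simp [f]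
  have hf : ∀ u v : ℚ, f (u + v * s) = u • 1 + v • M := by
    intro u v
    have : (u : K) + v * s = u • (1 : K) + v • s := by simp [Rat.smul_def]
    rw [this, map_add, map_smul, map_smul, hf1, hfs]
  refine ⟨AlgHom.ofLinearMap f hf1 ?_, hfs⟩
  intro x y
  obtain ⟨u, v, rfl⟩ := exists_rat_add_rat_mul_sqrt hdeg hirr x
  obtain ⟨u', v', rfl⟩ := exists_rat_add_rat_mul_sqrt hdeg hirr y
  have : ((u : K) + v * s) * (u' + v' * s) =
      (u * u' + D * (v * v') : ℚ) + (u * v' + v * u' : ℚ) * s := by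
    push_cast
    linear_combination (v * v' : K) * hs
  rw [this, hf, hf, hf]
  simp only [add_mul, mul_add, smul_mul_smul_comm, one_mul, mul_one, hM]
  module

theorem algHom_apply_rat_add_rat_mul {A : Type*} [Ring A] [Algebra ℚ A] (f : K →ₐ[ℚ] A)
    (u v : ℚ) (x : K) : f (u + v * x) = u • 1 + v • f x := by
  have : (u : K) + v * x = u • (1 : K) + v • x := by simp [Rat.smul_def]
  rw [this, map_add, map_smul, map_smul, map_one]

/-- Sending `(Dc² + cs)/2` to the Heegner matrix amounts to sending `s` to a trace zero matrix. -/
theorem algHom_heegner_iff {N c : ℕ} (hc : 1 ≤ c) {a b : ℤ}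
    (f : K →ₐ[ℚ] Matrix (Fin 2) (Fin 2) ℚ) :
    f (((D : K) * (c : K) ^ 2 + (c : K) * s) / 2) =
        !![((D * c ^ 2 + a : ℤ) : ℚ) / 2, -1;
           ((N : ℚ) * (b : ℚ)), ((D * c ^ 2 - a : ℤ) : ℚ) / 2] ↔
      f s = !![(a : ℚ) / c, -2 / c; 2 * N * b / c, -a / c] := by
  have hc0 : (c : ℚ) ≠ 0 := by positivity
  have hω : ((D : K) * (c : K) ^ 2 + (c : K) * s) / 2 =
      ((D * c ^ 2 / 2 : ℚ) : K) + ((c / 2 : ℚ) : K) * s := by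
    push_cast
    ring
  rw [hω, algHom_apply_rat_add_rat_mul]
  constructor
  · intro h
    ext i j
    have hij := congrFun (congrFun h i) j
    fin_cases i <;> fin_cases j <;> simp at hij ⊢ <;> field_simp at hij ⊢ <;> linarith
  · intro h
    rw [h]
    ext i j
    fin_cases i <;> fin_cases j <;> simp <;> field_simp <;> ring

end

theorem heegner_embedding_and_optimal_order
    (K : Type*) [Field K] [NumberField K]
    (himag : ∀ v : NumberField.InfinitePlace K, v.IsComplex)
    (hdeg : Module.finrank ℚ K = 2)
    (D : ℤ) (hDdef : D = NumberField.discr K)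
    (sqrtD : K) (hsqrtD : sqrtD ^ 2 = (D : K))
    (N c : ℕ) (hN : 1 ≤ N) (hc : 1 ≤ c)
    (a b : ℤ) (hab : a ^ 2 - 4 * N * b = D * c ^ 2) :
    -- (i) integrality of `(Dc² + a)/2` and `(Dc² - a)/2`
    (∃ x : ℤ, 2 * x = D * c ^ 2 + a) ∧ (∃ y : ℤ, 2 * y = D * c ^ 2 - a) ∧
    -- (i) existence and uniqueness of `ι`
    (∃! ι : K →ₐ[ℚ] Matrix (Fin 2) (Fin 2) ℚ,
      ι (((D : K) * (c : K) ^ 2 + (c : K) * sqrtD) / 2) =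
        !![((D * c ^ 2 + a : ℤ) : ℚ) / 2, -1;
           ((N : ℚ) * (b : ℚ)), ((D * c ^ 2 - a : ℤ) : ℚ) / 2]) ∧
    -- (ii) the preimage of the Eichler order is `ℤ + c𝒪_K`
    (∀ ι : K →ₐ[ℚ] Matrix (Fin 2) (Fin 2) ℚ,
      ι (((D : K) * (c : K) ^ 2 + (c : K) * sqrtD) / 2) =
        !![((D * c ^ 2 + a : ℤ) : ℚ) / 2, -1;
           ((N : ℚ) * (b : ℚ)), ((D * c ^ 2 - a : ℤ) : ℚ) / 2] →
      (fun x : K => ι x) ⁻¹'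
          {A : Matrix (Fin 2) (Fin 2) ℚ |
            (∀ i j, ∃ z : ℤ, A i j = (z : ℚ)) ∧
            (∃ z : ℤ, A 1 0 = ((N : ℤ) * z : ℤ))} =
        {x : K | ∃ (m : ℤ) (y : 𝓞 K),
          x = (m : K) + (c : K) * algebraMap (𝓞 K) K y}) := by
  have hirr := ratCast_ne_of_sq_eq_of_neg hsqrtD
    (hDdef ▸ discr_neg_of_isTotallyComplex_of_finrank_eq_two himag hdeg)
  have h4 := four_dvd_sq_sub_self_of_discr hdeg hirr hsqrtD hDdef
  obtain ⟨w, hw⟩ : ∃ w : 𝓞 K, (w : K) = (D + sqrtD) / 2 :=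
    ⟨⟨_, mem_integralClosure_iff ℤ K |>.mpr (isIntegral_discr_add_sqrt_div_two hsqrtD h4)⟩, rfl⟩
  have hc0 : (c : ℚ) ≠ 0 := by positivity
  have habQ : (a : ℚ) ^ 2 - 4 * N * b = D * c ^ 2 := by exact_mod_cast hab
  obtain ⟨g, hg⟩ : Even (a - D * c) :=
    int_even_sub_mul_of_four_dvd ⟨N * b, by linear_combination hab⟩
  obtain ⟨r, hr⟩ : Even (D * c * (c + 1)) := by
    rw [mul_assoc]
    exact (Int.even_mul_succ_self c).mul_left D
  refine ⟨⟨r + g, by linear_combination -hr - hg⟩,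
    ⟨r - D * c - g, by linear_combination hg - hr⟩, ?_, ?_⟩
  · obtain ⟨f, hf⟩ := exists_algHom_of_sq_eq hdeg hirr hsqrtD
      !![(a : ℚ) / c, -2 / c; 2 * N * b / c, -a / c] (by
        ext i j
        fin_cases i <;> fin_cases j <;> simp [Matrix.mul_apply] <;> field_simp <;>
          first | linear_combination habQ | ring)
    refine ⟨f, (algHom_heegner_iff hc f).mpr hf, ?_⟩
    intro f' hf'
    ext1 x
    obtain ⟨u, v, rfl⟩ := exists_rat_add_rat_mul_sqrt hdeg hirr x
    rw [algHom_apply_rat_add_rat_mul, algHom_apply_rat_add_rat_mul, hf,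
      (algHom_heegner_iff hc f').mp hf']
  · intro f hf
    rw [algHom_heegner_iff hc] at hf
    ext x
    simp only [Set.mem_preimage, Set.mem_ofPred_eq]
    obtain ⟨u, v, rfl⟩ := exists_rat_add_rat_mul_sqrt hdeg hirr x
    rw [algHom_apply_rat_add_rat_mul, hf]
    constructor
    · rintro ⟨hint, -⟩
      obtain ⟨l, hl⟩ := hint 0 0
      obtain ⟨j, hj⟩ := hint 0 1
      simp at hl hj
      have hv : v = -j * c / 2 := by
        rw [← hj]
        field_simp
      have hu : u = l + j * a / 2 := by
        rw [hv] at hl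
        field_simp at hl
        linarith
      have hgK : (a : K) - D * c = g + g := by exact_mod_cast congrArg (Int.cast : ℤ → K) hg
      refine ⟨l + j * (g + D * c), w * (-j : ℤ), ?_⟩
      rw [map_mul, map_intCast, ← RingOfIntegers.coe_eq_algebraMap, hw, hu, hv]
      push_cast
      linear_combination (j / 2 : K) * hgK
    · rintro ⟨m, y, hy⟩
      obtain ⟨n, j, hnj⟩ := exists_eq_int_add_int_mul_of_ringOfIntegers hdeg hirr hsqrtD hDdef y
      rw [← RingOfIntegers.coe_eq_algebraMap, hnj] at hy
      have hy' : (u : K) + v * sqrtD =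
          ((m + c * n + c * j * D / 2 : ℚ) : K) + (c * j / 2 : ℚ) * sqrtD := by
        rw [hy]
        push_cast
        ring
      obtain ⟨rfl, rfl⟩ := rat_add_rat_mul_sqrt_inj hirr hy'
      have hgQ : (a : ℚ) = D * c + g + g := by
        have : (a : ℚ) - D * c = g + g := by exact_mod_cast congrArg (Int.cast : ℤ → ℚ) hg
        linear_combination this
      refine ⟨?_, j * b, ?_⟩
      · intro i k
        fin_cases i <;> fin_cases k
        · refine ⟨m + c * n + j * (D * c + g), ?_⟩
          simp [hgQ]
          field_simp
          ring
        · refine ⟨-j, ?_⟩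
          simp
          field_simp
        · refine ⟨N * b * j, ?_⟩
          simp
          field_simp
        · refine ⟨m + c * n - j * g, ?_⟩
          simp [hgQ]
          field_simp
          ring
      · simp
        field_simp
end
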